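/- arXiv:1001.0612 — 3 statements merged into one kernel-verified Lean document; each statement's English description precedes it below -/
import Mathlib

section
/- Let n ≥ 6 be even and let X be the number of bulbs on at the terminal time n of the standard lightbulb process on n bulbs. Let σ² = (n/4)(1 − λ_{n,2,𝐧}) + (n²/4)λ_{n,2,𝐧}, where 𝐧 = (1,…,n). Then sup over z ∈ ℝ of |P((X − n/2)/σ ≤ z) − P(Z ≤ z)| ≤ (n/(2σ²))·Δ̄₀ + 1.64·n/σ³ + 2/σ, where Z is a standard normal random variable and Δ̄₀ = 1/(2√n) + 1/(2n) + (1/3)e^{−n/2}. -/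
open MeasureTheory ProbabilityTheory Finset

/-- `λ_{n,b,s} = ∑_{t=0}^{b} C(b,t) (−2)^t (s)_t/(n)_t`. -/
noncomputable def lam (n b s : ℕ) : ℝ :=
  ∑ t ∈ Finset.range (b + 1),
    (b.choose t : ℝ) * (-2 : ℝ) ^ t * (s.descFactorial t : ℝ) / (n.descFactorial t : ℝ)

/-- `λ_{n,b,𝐬}` for a switch pattern `𝐬 = (s_1,…,s_k)`. -/
noncomputable def lamPat (n b : ℕ) {k : ℕ} (s : Fin k → ℕ) : ℝ := ∏ r, lam n b (s r)

/-- The arrays of switch variables having exactly `s r` switches in stage `r`. -/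
def validArrays (n k : ℕ) (s : Fin k → ℕ) : Finset (Fin k → Fin n → Bool) :=
  Finset.univ.filter (fun e => ∀ r, (Finset.univ.filter (fun j => e r j = true)).card = s r)

/-- Terminal state of bulb `j` (all bulbs initially off). -/
def bulbOn {n k : ℕ} (e : Fin k → Fin n → Bool) (j : Fin n) : Bool :=
  decide ((Finset.univ.filter (fun r => e r j = true)).card % 2 = 1)

/-- Number of bulbs on at the terminal time. -/
def numOn {n k : ℕ} (e : Fin k → Fin n → Bool) : ℕ :=
  (Finset.univ.filter (fun j => bulbOn e j = true)).card

/-- The standard switch pattern `𝐧 = (1,…,n)`: stage `r` toggles `r+1` bulbs for `r : Fin n`. -/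
def stdPattern (n : ℕ) : Fin n → ℕ := fun r => (r : ℕ) + 1

/-- The Walsh function on the cube `Fin n → Bool`. -/
noncomputable def walsh {n : ℕ} (T S : Fin n → Bool) : ℝ := ∏ j, if T j && S j then -1 else 1

/-- The points of the cube with exactly `s` true coordinates. -/
def level (n s : ℕ) : Finset (Fin n → Bool) :=
  Finset.univ.filter (fun f => (Finset.univ.filter (fun j => f j = true)).card = s)

lemma walsh_orthogonality {n : ℕ} (S S' : Fin n → Bool) :
    ∑ T, walsh T S * walsh T S' = if S = S' then (2 : ℝ) ^ n else 0 := by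
  have h1 : ∑ T : Fin n → Bool, walsh T S * walsh T S' =
      ∏ j, ∑ b : Bool, ((if b && S j then (-1 : ℝ) else 1) * (if b && S' j then -1 else 1)) := by
    rw [Finset.prod_univ_sum, Fintype.piFinset_univ]
    simp_rw [Finset.prod_mul_distrib, walsh]
  have h2 : ∀ j, ∑ b : Bool, ((if b && S j then (-1 : ℝ) else 1) *
      (if b && S' j then -1 else 1)) = if S j = S' j then 2 else 0 := by
    intro j
    cases S j <;> cases S' j <;> norm_num
  rw [h1, Finset.prod_congr rfl (fun j _ => h2 j)]
  split_ifs with h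
  · simp [h]
  · obtain ⟨j, hj⟩ := Function.ne_iff.mp h
    exact Finset.prod_eq_zero (Finset.mem_univ j) (by simp [hj])

lemma walsh_comm {n : ℕ} (T S : Fin n → Bool) : walsh T S = walsh S T := by
  simp [walsh, Bool.and_comm]

lemma abs_walsh {n : ℕ} (T S : Fin n → Bool) : |walsh T S| = 1 := by
  rw [walsh, Finset.abs_prod]
  exact Finset.prod_eq_one fun j _ => by split_ifs <;> simp

lemma walsh_parseval {n : ℕ} (g : (Fin n → Bool) → ℝ) :
    ∑ T, (∑ S, g S * walsh T S) ^ 2 = 2 ^ n * ∑ S, g S ^ 2 := by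
  have h : ∀ T : Fin n → Bool, (∑ S, g S * walsh T S) ^ 2 =
      ∑ S, ∑ S', g S * g S' * (walsh T S * walsh T S') := by
    intro T
    rw [sq, Finset.sum_mul_sum]
    exact Finset.sum_congr rfl fun S _ => Finset.sum_congr rfl fun S' _ => by ring
  simp_rw [h]
  rw [Finset.sum_comm]
  simp_rw [Finset.sum_comm (s := (Finset.univ : Finset (Fin n → Bool)))
    (f := fun T S' => _ * _ * (walsh T _ * walsh T S')), ← Finset.mul_sum, walsh_orthogonality]
  rw [Finset.mul_sum]
  refine Finset.sum_congr rfl fun S _ => ?_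
  simp
  ring

lemma card_level (n s : ℕ) : (level n s).card = n.choose s := by
  have h := Finset.card_powersetCard s (Finset.univ : Finset (Fin n))
  rw [Finset.card_univ, Fintype.card_fin] at h
  rw [← h]
  refine Finset.card_bij' (fun f _ => Finset.univ.filter (fun j => f j = true))
    (fun A _ => fun j => decide (j ∈ A)) ?_ ?_ ?_ ?_
  · intro f hf
    simpa [level, Finset.mem_powersetCard] using hf
  · intro A hA
    simpa [level, Finset.mem_powersetCard] using hA
  · intro f hf
    ext j
    simp
  · intro A hA
    ext j
    simp

/-- The sum of a Walsh function over a level of the cube. -/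
noncomputable def levelSum (n s : ℕ) (T : Fin n → Bool) : ℝ := ∑ f ∈ level n s, walsh T f

lemma walsh_comp_perm {n : ℕ} (T S : Fin n → Bool) (π : Equiv.Perm (Fin n)) :
    walsh (T ∘ π) (S ∘ π) = walsh T S := by
  unfold walsh
  exact Equiv.prod_comp π (fun j => if T j && S j then (-1 : ℝ) else 1)

lemma comp_perm_mem_level {n s : ℕ} {f : Fin n → Bool} (π : Equiv.Perm (Fin n))
    (hf : f ∈ level n s) : f ∘ π ∈ level n s := by
  simp only [level, Finset.mem_filter, Finset.mem_univ, true_and, Function.comp] at hf ⊢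
  rw [← hf]
  exact Finset.card_bij (fun j _ => π j) (by simp) (by simp)
    (fun b hb => ⟨π.symm b, by simpa using hb⟩)

lemma levelSum_comp_perm {n s : ℕ} (T : Fin n → Bool) (π : Equiv.Perm (Fin n)) :
    levelSum n s (T ∘ π) = levelSum n s T := by
  unfold levelSum
  refine Finset.sum_bij' (fun f _ => f ∘ π.symm) (fun f _ => f ∘ π) ?_ ?_ ?_ ?_ ?_
  · exact fun f hf => comp_perm_mem_level π.symm hf
  · exact fun f hf => comp_perm_mem_level π hf
  · intro f _; ext; simp
  · intro f _; ext; simp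
  · intro f _
    rw [← walsh_comp_perm T _ π]
    congr 1
    ext; simp

lemma exists_perm_of_mem_level {n s : ℕ} {f g : Fin n → Bool} (hf : f ∈ level n s)
    (hg : g ∈ level n s) : ∃ π : Equiv.Perm (Fin n), f ∘ π = g := by
  simp only [level, Finset.mem_filter, Finset.mem_univ, true_and] at hf hg
  have hc : Fintype.card {j // g j = true} = Fintype.card {j // f j = true} := by
    rw [Fintype.card_subtype, Fintype.card_subtype, hf, hg]
  let e := Fintype.equivOfCardEq hc
  refine ⟨e.extendSubtype, ?_⟩
  ext j
  by_cases hj : g j = true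
  · have := e.extendSubtype_mem j hj
    simp [hj, this]
  · have := e.extendSubtype_not_mem j hj
    simp only [Bool.not_eq_true] at this hj
    simp [hj, this]

lemma sum_levelSum_sq (n s : ℕ) :
    ∑ T, levelSum n s T ^ 2 = 2 ^ n * (n.choose s : ℝ) := by
  have h := walsh_parseval (fun f : Fin n → Bool => if f ∈ level n s then (1 : ℝ) else 0)
  simp only [ite_mul, one_mul, zero_mul, Finset.sum_ite_mem, Finset.univ_inter, ite_pow, one_pow,
    ne_eq, OfNat.ofNat_ne_zero, not_false_eq_true, zero_pow, Finset.sum_const, nsmul_eq_mul,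
    mul_one, card_level] at h
  exact h

lemma choose_mul_levelSum_sq_le {n s b : ℕ} {T : Fin n → Bool} (hT : T ∈ level n b) :
    (n.choose b : ℝ) * levelSum n s T ^ 2 ≤ 2 ^ n * (n.choose s : ℝ) := by
  have h : ∀ T' ∈ level n b, levelSum n s T' ^ 2 = levelSum n s T ^ 2 := by
    intro T' hT'
    obtain ⟨π, hπ⟩ := exists_perm_of_mem_level hT hT'
    rw [← hπ, levelSum_comp_perm]
  rw [← sum_levelSum_sq, ← card_level, ← nsmul_eq_mul, ← Finset.sum_const, ← Finset.sum_congr rfl h]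
  exact Finset.sum_le_univ_sum_of_nonneg fun _ => sq_nonneg _

lemma abs_levelSum_le (n s : ℕ) (T : Fin n → Bool) : |levelSum n s T| ≤ n.choose s := by
  refine (Finset.abs_sum_le_sum_abs _ _).trans ?_
  simp [abs_walsh, card_level]

lemma walsh_bulbOn {n k : ℕ} (e : Fin k → Fin n → Bool) (T : Fin n → Bool) :
    walsh T (bulbOn e) = ∏ r, walsh T (e r) := by
  unfold walsh
  rw [Finset.prod_comm]
  refine Finset.prod_congr rfl fun j _ => ?_
  cases hT : T j
  · simp
  · have h1 : (∏ r, if true && e r j then (-1 : ℝ) else 1) =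
        (-1) ^ (Finset.univ.filter (fun r => e r j = true)).card := by
      simp [Finset.prod_ite]
    rw [h1]
    rcases Nat.mod_two_eq_zero_or_one (Finset.univ.filter (fun r => e r j = true)).card with h | h
    · rw [(Nat.even_iff.mpr h).neg_one_pow]
      simp [bulbOn, h]
    · rw [(Nat.odd_iff.mpr h).neg_one_pow]
      simp [bulbOn, h]

lemma validArrays_eq_piFinset (n k : ℕ) (s : Fin k → ℕ) :
    validArrays n k s = Fintype.piFinset (fun r => level n (s r)) := by
  ext e
  simp [validArrays, level]

lemma card_validArrays (n k : ℕ) (s : Fin k → ℕ) :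
    (validArrays n k s).card = ∏ r, n.choose (s r) := by
  simp [validArrays_eq_piFinset, card_level]

lemma sum_walsh_bulbOn {n k : ℕ} (s : Fin k → ℕ) (T : Fin n → Bool) :
    ∑ e ∈ validArrays n k s, walsh T (bulbOn e) = ∏ r, levelSum n (s r) T := by
  simp_rw [walsh_bulbOn, levelSum]
  rw [Finset.prod_univ_sum, validArrays_eq_piFinset]

lemma walsh_false {n : ℕ} (S : Fin n → Bool) : walsh (fun _ => false) S = 1 := by
  simp [walsh]

lemma walsh_true {n b : ℕ} {S : Fin n → Bool} (hS : S ∈ level n b) :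
    walsh (fun _ => true) S = (-1) ^ b := by
  simp only [level, Finset.mem_filter, Finset.mem_univ, true_and] at hS
  simp [walsh, Finset.prod_ite, hS]

lemma le_choose_of_pos_of_lt {n b : ℕ} (hb : 0 < b) (hbn : b < n) : n ≤ n.choose b := by
  induction n generalizing b with
  | zero => omega
  | succ n ih =>
    obtain ⟨b, rfl⟩ : ∃ c, b = c + 1 := ⟨b - 1, by omega⟩
    rw [Nat.choose_succ_succ]
    rcases Nat.lt_or_ge (b + 1) n with h | h
    · have := ih (Nat.succ_pos b) h
      have := Nat.choose_pos (show b ≤ n by omega)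
      omega
    · obtain rfl : n = b + 1 := by omega
      simp [Nat.choose_succ_self_right]

/-- The normalised character sum of one stage. -/
noncomputable def stageChar (n s : ℕ) (T : Fin n → Bool) : ℝ := levelSum n s T / n.choose s

lemma stageChar_sq_le_one (n s : ℕ) (T : Fin n → Bool) : stageChar n s T ^ 2 ≤ 1 := by
  rw [sq_le_one_iff_abs_le_one, stageChar, abs_div, Nat.abs_cast]
  exact div_le_one_of_le₀ (abs_levelSum_le n s T) (Nat.cast_nonneg _)

lemma sum_stageChar_sq {n s : ℕ} (hs : s ≤ n) :
    ∑ T, stageChar n s T ^ 2 = 2 ^ n / (n.choose s : ℝ) := by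
  have h0 : (n.choose s : ℝ) ≠ 0 := by exact_mod_cast (Nat.choose_pos hs).ne'
  simp_rw [stageChar, div_pow]
  rw [← Finset.sum_div, sum_levelSum_sq]
  field_simp

lemma stageChar_sq_le {n s : ℕ} (hs : s ≤ n) {T : Fin n → Bool} (h0 : T ≠ fun _ => false)
    (h1 : T ≠ fun _ => true) : stageChar n s T ^ 2 ≤ 2 ^ n / (n.choose s : ℝ) / n := by
  set b := (Finset.univ.filter (fun j => T j = true)).card with hb
  have hT : T ∈ level n b := by simp [level, hb]
  have hb0 : 0 < b := by
    rw [hb, Finset.card_pos]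
    by_contra hc
    rw [Finset.not_nonempty_iff_eq_empty, Finset.filter_eq_empty_iff] at hc
    exact h0 (funext fun j => by simpa using hc (Finset.mem_univ j))
  have hbn : b < n := by
    have : b < (Finset.univ : Finset (Fin n)).card := by
      apply Finset.card_lt_card
      rw [Finset.filter_ssubset]
      by_contra hc
      push Not at hc
      exact h1 (funext fun j => by simpa using hc j (Finset.mem_univ j))
    simpa using this
  have hn : (n : ℝ) ≤ n.choose b := by exact_mod_cast le_choose_of_pos_of_lt hb0 hbn
  have hc : (0 : ℝ) < n.choose s := by exact_mod_cast Nat.choose_pos hs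
  have hn0 : (0 : ℝ) < n := by exact_mod_cast hb0.trans hbn
  have h := choose_mul_levelSum_sq_le (s := s) hT
  rw [stageChar, div_pow, div_div, div_le_div_iff₀ (by positivity) (by positivity)]
  have h2 : (n : ℝ) * levelSum n s T ^ 2 ≤ 2 ^ n * n.choose s :=
    (mul_le_mul_of_nonneg_right hn (sq_nonneg _)).trans h
  nlinarith

/-- The law of the terminal state minus the uniform law on the states of the right parity,
where `κ` is the sign of that parity. -/
noncomputable def stateDiff {n k : ℕ} (s : Fin k → ℕ) (S : Fin n → Bool) : ℝ :=
  ((validArrays n k s).filter (fun e => bulbOn e = S)).card / (validArrays n k s).card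
    - (1 + (∏ r, (-1 : ℝ) ^ s r) * walsh (fun _ => true) S) / 2 ^ n

lemma levelSum_false (n s : ℕ) : levelSum n s (fun _ => false) = n.choose s := by
  simp [levelSum, walsh_false, card_level]

lemma levelSum_true (n s : ℕ) : levelSum n s (fun _ => true) = (-1) ^ s * n.choose s := by
  rw [levelSum, Finset.sum_congr rfl fun f hf => walsh_true hf]
  simp [card_level, mul_comm]

lemma walsh_stateDiff {n k : ℕ} (hn : 0 < n) {s : Fin k → ℕ} (hs : ∀ r, s r ≤ n)
    (T : Fin n → Bool) :
    ∑ S, stateDiff s S * walsh T S =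
      if T = (fun _ => false) ∨ T = (fun _ => true) then 0 else ∏ r, stageChar n (s r) T := by
  have hne : (fun _ : Fin n => true) ≠ fun _ => false := fun h => by
    simpa using congrFun h ⟨0, hn⟩
  have hc : ∀ r, (n.choose (s r) : ℝ) ≠ 0 := fun r => by
    exact_mod_cast (Nat.choose_pos (hs r)).ne'
  have h1 : ∑ S, (((validArrays n k s).filter (fun e => bulbOn e = S)).card : ℝ) * walsh T S
      = ∏ r, levelSum n (s r) T := by
    rw [← sum_walsh_bulbOn, ← Finset.sum_fiberwise (validArrays n k s) (fun e => bulbOn e)]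
    refine Finset.sum_congr rfl fun S _ => ?_
    rw [Finset.sum_congr rfl (g := fun _ => walsh T S) fun e he => by
      rw [(Finset.mem_filter.mp he).2]]
    simp
  have h2 : ∑ S, walsh T S = if T = (fun _ => false) then (2 : ℝ) ^ n else 0 := by
    rw [← walsh_orthogonality]
    exact Finset.sum_congr rfl fun S _ => by rw [walsh_comm S, walsh_comm S, walsh_false, mul_one]
  have h3 : ∑ S, walsh (fun _ => true) S * walsh T S =
      if T = (fun _ => true) then (2 : ℝ) ^ n else 0 := by
    simp_rw [eq_comm (a := T)]
    rw [← walsh_orthogonality]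
    exact Finset.sum_congr rfl fun S _ => by rw [walsh_comm S, walsh_comm S]
  have h4 : ∑ S, stateDiff s S * walsh T S = ∏ r, stageChar n (s r) T
      - ((if T = (fun _ => false) then (2 : ℝ) ^ n else 0) + (∏ r, (-1 : ℝ) ^ s r) *
        (if T = (fun _ => true) then (2 : ℝ) ^ n else 0)) / 2 ^ n := by
    rw [← h2, ← h3, Finset.mul_sum, ← Finset.sum_add_distrib, Finset.sum_div]
    simp only [stageChar]
    rw [Finset.prod_div_distrib, ← h1, Finset.sum_div, ← Finset.sum_sub_distrib]
    refine Finset.sum_congr rfl fun S _ => ?_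
    rw [stateDiff, card_validArrays]
    push_cast
    ring
  rw [h4]
  by_cases hf : T = fun _ => false
  · subst hf
    simp [hne.symm, stageChar, levelSum_false, hc]
  · by_cases ht : T = fun _ => true
    · subst ht
      simp [hne, stageChar, levelSum_true, hc]
    · simp [hf, ht]

lemma sq_sum_abs_stateDiff_le {n k : ℕ} (hn : 0 < n) {s : Fin k → ℕ} (hs : ∀ r, s r ≤ n)
    {C : ℝ} (hC0 : 0 ≤ C) (r₀ : Fin k)
    (hC : ∀ T : Fin n → Bool, T ≠ (fun _ => false) → T ≠ (fun _ => true) →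
      ∏ r ∈ Finset.univ.erase r₀, stageChar n (s r) T ^ 2 ≤ C) :
    (∑ S : Fin n → Bool, |stateDiff s S|) ^ 2 ≤ 2 ^ n / (n.choose (s r₀) : ℝ) * C := by
  have h1 := sq_sum_le_card_mul_sum_sq (s := (Finset.univ : Finset (Fin n → Bool)))
    (f := fun S => |stateDiff s S|)
  simp only [sq_abs, Finset.card_univ, Fintype.card_fun, Fintype.card_bool, Fintype.card_fin,
    Nat.cast_pow, Nat.cast_ofNat] at h1
  rw [← walsh_parseval] at h1
  refine h1.trans ?_
  rw [← sum_stageChar_sq (hs r₀), Finset.sum_mul]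
  refine Finset.sum_le_sum fun T _ => ?_
  rw [walsh_stateDiff hn hs]
  split_ifs with h
  · rw [zero_pow two_ne_zero]
    positivity
  · push Not at h
    rw [← Finset.prod_pow, ← Finset.mul_prod_erase _ _ (Finset.mem_univ r₀)]
    exact mul_le_mul_of_nonneg_left (hC T h.1 h.2) (sq_nonneg _)

lemma centralBinom_sq_eq (h : ℕ) :
    (h.centralBinom : ℝ) ^ 2 * (2 * h + 1) * Real.Wallis.W h = 2 ^ (4 * h) := by
  rw [Real.Wallis.W_eq_factorial_ratio]
  have h1 : (h.centralBinom : ℝ) * (h.factorial : ℝ) ^ 2 = (2 * h).factorial := by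
    have := Nat.choose_mul_factorial_mul_factorial (show h ≤ 2 * h by omega)
    rw [show 2 * h - h = h by omega] at this
    rw [Nat.centralBinom_eq_two_mul_choose, sq, ← mul_assoc]
    exact_mod_cast this
  have h2 : (h.factorial : ℝ) ≠ 0 := by exact_mod_cast h.factorial_ne_zero
  have h3 : (h.centralBinom : ℝ) ≠ 0 := by exact_mod_cast h.centralBinom_ne_zero
  have h4 : (2 * (h : ℝ) + 1) ≠ 0 := by positivity
  rw [← h1]
  field_simp

lemma two_pow_sq_le_centralBinom_sq (h : ℕ) :
    (2 : ℝ) ^ (4 * h) ≤ (h.centralBinom : ℝ) ^ 2 * (2 * h + 1) * (Real.pi / 2) := by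
  rw [← centralBinom_sq_eq]
  exact mul_le_mul_of_nonneg_left (Real.Wallis.W_le h) (by positivity)

lemma centralBinom_sq_le_two_pow_sq (h : ℕ) :
    (h.centralBinom : ℝ) ^ 2 * (2 * h + 1) ^ 2 / (2 * h + 2) * (Real.pi / 2) ≤ 2 ^ (4 * h) := by
  rw [← centralBinom_sq_eq]
  have := mul_le_mul_of_nonneg_left (Real.Wallis.le_W h)
    (show (0 : ℝ) ≤ (h.centralBinom : ℝ) ^ 2 * (2 * h + 1) by positivity)
  refine le_trans (le_of_eq ?_) this
  ring

lemma choose_add_le_centralBinom_mul_exp (h d : ℕ) :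
    ((2 * h).choose (h + d) : ℝ) ≤
      h.centralBinom * Real.exp (-(d : ℝ) ^ 2 / (h + 1 / 2)) := by
  induction d with
  | zero => simp [Nat.centralBinom_eq_two_mul_choose]
  | succ d ih =>
    rcases Nat.lt_or_ge h (d + 1) with hd | hd
    · rw [Nat.choose_eq_zero_of_lt (by omega)]
      simp only [Nat.cast_zero]
      positivity
    have h1 : ((2 * h).choose (h + (d + 1)) : ℝ) * (h + d + 1) =
        (2 * h).choose (h + d) * (h - d) := by
      have := Nat.choose_succ_right_eq (2 * h) (h + d)
      rw [show 2 * h - (h + d) = h - d by omega] at this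
      rw [← Nat.cast_sub (by omega : d ≤ h)]
      exact_mod_cast this
    have hpos : (0 : ℝ) < h + d + 1 := by positivity
    have hdh : (d : ℝ) + 1 ≤ h := by exact_mod_cast hd
    have hd0 : (0 : ℝ) ≤ d := Nat.cast_nonneg _
    have key : ((h : ℝ) - d) / (h + d + 1) ≤ Real.exp (-(2 * d + 1) / (h + 1 / 2)) := by
      set u : ℝ := (d + 1 / 2) / (h + 1 / 2) with hu
      have hu0 : 0 ≤ u := by positivity
      have hu1 : u < 1 := by rw [hu, div_lt_one (by positivity)]; linarith
      have e1 : ((h : ℝ) - d) / (h + d + 1) = (1 - u) / (1 + u) := by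
        rw [hu]
        have : (h : ℝ) + 1 / 2 ≠ 0 := by positivity
        field_simp
        ring
      have e2 : -(2 * (d : ℝ) + 1) / (h + 1 / 2) = -(2 * u) := by
        rw [hu]; ring
      have hu2 : 0 < 1 - u := by linarith
      have hlog := Real.le_log_one_add_of_nonneg (x := 2 * u / (1 - u)) (by positivity)
      have e3 : 2 * (2 * u / (1 - u)) / (2 * u / (1 - u) + 2) = 2 * u := by
        field_simp
        ring
      have e4 : 1 + 2 * u / (1 - u) = (1 + u) / (1 - u) := by
        field_simp
        ring
      rw [e3, e4, Real.le_log_iff_exp_le (by positivity)] at hlog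
      rw [e1, e2, Real.exp_neg, ← inv_div]
      exact inv_anti₀ (Real.exp_pos _) hlog
    have h2 : ((2 * h).choose (h + (d + 1)) : ℝ) =
        (2 * h).choose (h + d) * ((h - d) / (h + d + 1)) := by
      rw [← mul_div_assoc, ← h1]
      field_simp
    rw [h2]
    have hkn : 0 ≤ ((h : ℝ) - d) / (h + d + 1) := div_nonneg (by linarith) hpos.le
    refine (mul_le_mul ih key hkn (by positivity)).trans (le_of_eq ?_)
    rw [mul_assoc, ← Real.exp_add]
    congr 2
    push_cast
    ring

lemma choose_le_centralBinom_mul_exp (h k : ℕ) :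
    ((2 * h).choose k : ℝ) ≤
      h.centralBinom * Real.exp (-((k : ℝ) - h) ^ 2 / (h + 1 / 2)) := by
  rcases Nat.le_total h k with hk | hk
  · obtain ⟨d, rfl⟩ := Nat.exists_eq_add_of_le hk
    have := choose_add_le_centralBinom_mul_exp h d
    push_cast
    rwa [add_sub_cancel_left]
  · obtain ⟨d, rfl⟩ := Nat.exists_eq_add_of_le hk
    have := choose_add_le_centralBinom_mul_exp (k + d) d
    rw [← Nat.choose_symm (by omega), show 2 * (k + d) - (k + d + d) = k by omega] at this
    push_cast at this ⊢
    rw [show ((k : ℝ) - (k + d)) ^ 2 = (d : ℝ) ^ 2 by ring]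
    exact this

lemma two_mul_choose_div_le_pdf (h k : ℕ) (v : NNReal) (hv : (v : ℝ) = (2 * h + 1) / 4) :
    2 * ((2 * h).choose k : ℝ) / 2 ^ (2 * h) ≤
      (1 + 1 / (2 * h + 1)) * (2 * gaussianPDFReal 0 v ((k : ℝ) - h)) := by
  have hpi := Real.pi_pos
  have hc : (h.centralBinom : ℝ) / 2 ^ (2 * h) ≤
      (1 + 1 / (2 * h + 1)) * (√(2 * Real.pi * v))⁻¹ := by
    have hW := centralBinom_sq_le_two_pow_sq h
    have hs : 2 * Real.pi * v = Real.pi / 2 * (2 * h + 1) := by rw [hv]; ring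
    have h4 : (2 : ℝ) ^ (4 * h) = (2 ^ (2 * h)) ^ 2 := by ring
    refine le_of_sq_le_sq ?_ (by positivity)
    rw [mul_pow, inv_pow, Real.sq_sqrt (by positivity), hs, div_pow, ← h4,
      div_le_iff₀ (by positivity)]
    have h0 : (0 : ℝ) ≤ h := Nat.cast_nonneg h
    have e : (1 + 1 / (2 * (h : ℝ) + 1)) ^ 2 * (Real.pi / 2 * (2 * h + 1))⁻¹ * 2 ^ (4 * h) =
        ((2 * h + 2) / (2 * h + 1) ^ 2 * (Real.pi / 2)⁻¹) * 2 ^ (4 * h) *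
          ((2 * h + 2) / (2 * h + 1)) := by
      field_simp
      ring
    rw [e]
    have h5 : (h.centralBinom : ℝ) ^ 2 ≤
        ((2 * h + 2) / (2 * h + 1) ^ 2 * (Real.pi / 2)⁻¹) * 2 ^ (4 * h) := by
      refine le_trans (le_of_eq ?_) (mul_le_mul_of_nonneg_left hW (by positivity))
      field_simp
    refine h5.trans (le_mul_of_one_le_right (by positivity) ?_)
    rw [one_le_div (by positivity)]
    linarith
  rw [gaussianPDFReal_def]
  have he : -((k : ℝ) - h - 0) ^ 2 / (2 * v) = -((k : ℝ) - h) ^ 2 / (h + 1 / 2) := by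
    rw [hv]; ring_nf
  simp only [he]
  have h1 := choose_le_centralBinom_mul_exp h k
  calc 2 * ((2 * h).choose k : ℝ) / 2 ^ (2 * h)
      ≤ 2 * (h.centralBinom * Real.exp (-((k : ℝ) - h) ^ 2 / (h + 1 / 2))) / 2 ^ (2 * h) := by
        gcongr
    _ = 2 * (h.centralBinom / 2 ^ (2 * h)) * Real.exp (-((k : ℝ) - h) ^ 2 / (h + 1 / 2)) := by ring
    _ ≤ 2 * ((1 + 1 / (2 * h + 1)) * (√(2 * Real.pi * v))⁻¹) *
        Real.exp (-((k : ℝ) - h) ^ 2 / (h + 1 / 2)) := by gcongr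
    _ = _ := by ring

lemma gaussianReal_Iic_mul {c : ℝ} (hc : 0 < c) (v : NNReal) (hv : (v : ℝ) = c ^ 2) (z : ℝ) :
    gaussianReal 0 v (Set.Iic (c * z)) = gaussianReal 0 1 (Set.Iic z) := by
  have h := gaussianReal_map_const_mul (μ := 0) (v := 1) c
  have hv' : (NNReal.mk (c ^ 2) (sq_nonneg _) * 1 : NNReal) = v := by
    rw [mul_one]; exact NNReal.eq hv.symm
  rw [hv', mul_zero] at h
  rw [← h, Measure.map_apply (by fun_prop) measurableSet_Iic]
  congr 1
  ext x
  exact mul_le_mul_iff_right₀ hc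

lemma gaussianReal_real_eq (v : NNReal) (hv : v ≠ 0) (s : Set ℝ) :
    (gaussianReal 0 v).real s = ∫ x in s, gaussianPDFReal 0 v x := by
  rw [Measure.real, gaussianReal_apply_eq_integral _ hv, ENNReal.toReal_ofReal]
  exact integral_nonneg fun x => gaussianPDFReal_nonneg _ _ _

lemma gaussianReal_real_le_of_var_le {u v : NNReal} (hu : u ≠ 0) (huv : u ≤ v) (s : Set ℝ) :
    (gaussianReal 0 u).real s ≤ √(v / u) * (gaussianReal 0 v).real s := by
  have hu0 : (0 : ℝ) < u := by exact_mod_cast pos_iff_ne_zero.mpr hu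
  have huv' : (u : ℝ) ≤ v := by exact_mod_cast huv
  have hv0 : (0 : ℝ) < v := hu0.trans_le huv'
  have hv : v ≠ 0 := by rintro rfl; simp at hv0
  have hpi := Real.pi_pos
  rw [gaussianReal_real_eq _ hu, gaussianReal_real_eq _ hv, ← integral_const_mul]
  refine integral_mono (integrable_gaussianPDFReal _ _).restrict
    ((integrable_gaussianPDFReal _ _).restrict.const_mul _) fun x => ?_
  simp only [gaussianPDFReal_def, sub_zero]
  have h1 : √((v : ℝ) / u) * (√(2 * Real.pi * v))⁻¹ = (√(2 * Real.pi * u))⁻¹ := by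
    rw [← Real.sqrt_inv, ← Real.sqrt_inv, ← Real.sqrt_mul (by positivity)]
    congr 1
    field_simp
  rw [← mul_assoc, h1]
  refine mul_le_mul_of_nonneg_left (Real.exp_le_exp.mpr ?_) (by positivity)
  rw [div_le_div_iff₀ (by positivity) (by positivity)]
  nlinarith [sq_nonneg x]

lemma gaussianReal_real_Ioc_le (v : NNReal) (hv : v ≠ 0) {a b : ℝ} (hab : a ≤ b) :
    (gaussianReal 0 v).real (Set.Ioc a b) ≤ (√(2 * Real.pi * v))⁻¹ * (b - a) := by
  rw [gaussianReal_real_eq _ hv]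
  have h : ∫ x in Set.Ioc a b, gaussianPDFReal 0 v x ≤
      ∫ x in Set.Ioc a b, (√(2 * Real.pi * v))⁻¹ := by
    refine integral_mono (integrable_gaussianPDFReal _ _).restrict (integrable_const _) fun x => ?_
    simp only [gaussianPDFReal_def, sub_zero]
    refine mul_le_of_le_one_right (by positivity) (Real.exp_le_one_iff.mpr ?_)
    exact div_nonpos_of_nonpos_of_nonneg (by nlinarith [sq_nonneg x]) (by positivity)
  refine h.trans (le_of_eq ?_)
  simp [hab, mul_comm]

lemma pdf_le_gaussianReal_real_Ioc (v : NNReal) (hv : v ≠ 0) (d : ℝ) :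
    2 * gaussianPDFReal 0 v d ≤
      Real.exp (1 / (2 * v)) * (gaussianReal 0 v).real (Set.Ioc (d - 1) (d + 1)) := by
  have hv0 : (0 : ℝ) < v := by exact_mod_cast pos_iff_ne_zero.mpr hv
  rw [gaussianReal_real_eq _ hv, ← integral_const_mul]
  have h : ∫ x in Set.Ioc (d - 1) (d + 1), gaussianPDFReal 0 v d * (1 - d / v * (x - d)) ≤
      ∫ x in Set.Ioc (d - 1) (d + 1), Real.exp (1 / (2 * v)) * gaussianPDFReal 0 v x := by
    refine setIntegral_mono_on ?_ ((integrable_gaussianPDFReal _ _).const_mul _).integrableOn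
      measurableSet_Ioc fun x hx => ?_
    · exact (Continuous.integrableOn_Icc (by fun_prop)).mono_set Set.Ioc_subset_Icc_self
    · simp only [gaussianPDFReal_def, sub_zero]
      have hu : (x - d) ^ 2 ≤ 1 := by
        have := hx.1
        have := hx.2
        nlinarith
      have e1 : Real.exp (1 / (2 * v)) * ((√(2 * Real.pi * v))⁻¹ * Real.exp (-x ^ 2 / (2 * v)))
          = (√(2 * Real.pi * v))⁻¹ * Real.exp (-d ^ 2 / (2 * v)) *
            Real.exp (-(d / v * (x - d)) + (1 - (x - d) ^ 2) / (2 * v)) := by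
        rw [mul_left_comm, ← Real.exp_add, mul_assoc (√(2 * Real.pi * v))⁻¹, ← Real.exp_add]
        congr 2
        field_simp
        ring
      rw [e1]
      refine mul_le_mul_of_nonneg_left ?_ (by positivity)
      refine le_trans ?_ (Real.add_one_le_exp _)
      have : 0 ≤ (1 - (x - d) ^ 2) / (2 * v) := div_nonneg (by linarith) (by positivity)
      linarith
  refine le_trans (le_of_eq ?_) h
  rw [← intervalIntegral.integral_of_le (by linarith), intervalIntegral.integral_const_mul,
    intervalIntegral.integral_sub (by simp) (by apply Continuous.intervalIntegrable; fun_prop),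
    intervalIntegral.integral_const_mul, intervalIntegral.integral_comp_sub_right (fun x => x)]
  simp
  ring

lemma abs_real_sub_le_of_le_mul {α : Type*} [MeasurableSpace α] {μ ν : Measure α}
    [IsProbabilityMeasure μ] [IsProbabilityMeasure ν] {c : ℝ}
    (h : ∀ s, MeasurableSet s → μ.real s ≤ c * ν.real s) {s : Set α} (hs : MeasurableSet s) :
    |μ.real s - ν.real s| ≤ c - 1 := by
  have h1 := h s hs
  have h2 := h sᶜ hs.compl
  rw [probReal_compl_eq_one_sub hs, probReal_compl_eq_one_sub hs] at h2
  have h3 := h Set.univ MeasurableSet.univ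
  rw [probReal_univ, probReal_univ] at h3
  have h4 : ν.real s ≤ 1 := measureReal_le_one
  have h5 : 0 ≤ ν.real s := measureReal_nonneg
  rw [abs_le]
  constructor <;> nlinarith

/-- The number of true coordinates. -/
def trueCount {n : ℕ} (S : Fin n → Bool) : ℕ :=
  (Finset.univ.filter (fun j => S j = true)).card

/-- The binomial law with fair coins, conditioned on the parity with sign `κ`. -/
noncomputable def parityBinomial (n : ℕ) (κ : ℝ) (k : ℕ) : ℝ :=
  (n.choose k : ℝ) * ((1 + κ * (-1) ^ k) / 2 ^ n)

lemma sum_parityUniform_eq (n : ℕ) (κ : ℝ) (p : ℕ → Prop) [DecidablePred p] :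
    ∑ S : Fin n → Bool with p (trueCount S), (1 + κ * walsh (fun _ => true) S) / 2 ^ n =
      ∑ k ∈ Finset.range (n + 1) with p k, parityBinomial n κ k := by
  have hmaps : ∀ S ∈ (Finset.univ.filter fun S : Fin n → Bool => p (trueCount S)),
      trueCount S ∈ (Finset.range (n + 1)).filter p := by
    intro S hS
    have : trueCount S ≤ n := by
      simpa [trueCount] using Finset.card_le_univ (Finset.univ.filter (fun j => S j = true))
    simp only [Finset.mem_filter, Finset.mem_univ, true_and] at hS
    simp [hS, Nat.lt_succ_of_le this]
  rw [← Finset.sum_fiberwise_of_maps_to hmaps]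
  refine Finset.sum_congr rfl fun k hk => ?_
  have hk' := (Finset.mem_filter.mp hk).2
  have hset : (Finset.univ.filter fun S : Fin n → Bool => p (trueCount S)).filter
      (fun S => trueCount S = k) = level n k := by
    ext S
    simp only [level, Finset.mem_filter, Finset.mem_univ, true_and]
    change p (trueCount S) ∧ trueCount S = k ↔ trueCount S = k
    exact ⟨fun h => h.2, fun h => ⟨h ▸ hk', h⟩⟩
  rw [hset, Finset.sum_congr rfl fun S hS => by rw [walsh_true hS]]
  simp [parityBinomial, card_level]

lemma sum_parityBinomial {n : ℕ} (hn : 0 < n) (κ : ℝ) :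
    ∑ k ∈ Finset.range (n + 1), parityBinomial n κ k = 1 := by
  have h := sum_parityUniform_eq n κ (fun _ => True)
  simp only [Finset.filter_true] at h
  rw [← h, ← Finset.sum_div, Finset.sum_add_distrib, ← Finset.mul_sum]
  have h2 : ∑ S : Fin n → Bool, walsh (fun _ => true) S = 0 := by
    have hne : (fun _ : Fin n => true) ≠ fun _ => false := fun h => by
      simpa using congrFun h ⟨0, hn⟩
    have := walsh_orthogonality (fun _ : Fin n => true) (fun _ => false)
    rw [if_neg hne] at this
    rw [← this]
    exact Finset.sum_congr rfl fun S _ => by rw [walsh_comm S, walsh_comm S, walsh_false, mul_one]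
  rw [h2]
  simp

lemma sum_parityBinomial_le_gaussian (h : ℕ) {κ : ℝ} (hκ : κ = 1 ∨ κ = -1) (v : NNReal)
    (hv : (v : ℝ) = (2 * h + 1) / 4) (D : Finset ℕ) (B : Set ℝ)
    (hB : ∀ k ∈ D, Set.Ioc ((k : ℝ) - h - 1) (k - h + 1) ⊆ B) :
    ∑ k ∈ D, parityBinomial (2 * h) κ k ≤
      (1 + 1 / (2 * h + 1)) * Real.exp (1 / (2 * v)) * (gaussianReal 0 v).real B := by
  have hv0 : v ≠ 0 := by
    rintro rfl
    have : (0 : ℝ) ≤ h := Nat.cast_nonneg h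
    simp only [NNReal.coe_zero] at hv
    linarith
  set c : ℝ := (1 + 1 / (2 * h + 1)) * Real.exp (1 / (2 * v)) with hc
  have hc0 : 0 ≤ c := by positivity
  have hterm : ∀ k ∈ D, parityBinomial (2 * h) κ k ≤ if (-1 : ℝ) ^ k = κ then
      c * (gaussianReal 0 v).real (Set.Ioc ((k : ℝ) - h - 1) (k - h + 1)) else 0 := by
    intro k _
    split_ifs with hk
    · have h1 := two_mul_choose_div_le_pdf h k v hv
      have h2 := pdf_le_gaussianReal_real_Ioc v hv0 ((k : ℝ) - h)
      have h3 : parityBinomial (2 * h) κ k = 2 * ((2 * h).choose k : ℝ) / 2 ^ (2 * h) := by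
        have : κ * κ = 1 := by rcases hκ with rfl | rfl <;> norm_num
        rw [parityBinomial, hk, this]
        ring
      rw [h3, hc, mul_assoc]
      exact h1.trans (mul_le_mul_of_nonneg_left h2 (by positivity))
    · refine le_of_eq ?_
      have : κ * (-1) ^ k = -1 := by
        rcases neg_one_pow_eq_or ℝ k with h | h <;> rcases hκ with rfl | rfl <;>
          simp_all
      rw [parityBinomial, this]
      simp
  refine (Finset.sum_le_sum hterm).trans ?_
  rw [← Finset.sum_filter, ← Finset.mul_sum]
  refine mul_le_mul_of_nonneg_left ?_ hc0
  rw [← measureReal_biUnion_finset ?_ fun k _ => measurableSet_Ioc]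
  · refine measureReal_mono (Set.iUnion₂_subset fun k hk => hB k (Finset.mem_filter.mp hk).1)
  · intro k hk l hl hkl
    have hk2 := (Finset.mem_filter.mp hk).2
    have hl2 := (Finset.mem_filter.mp hl).2
    have key : k + 2 ≤ l ∨ l + 2 ≤ k := by
      by_contra hcon
      have : l = k + 1 ∨ k = l + 1 := by omega
      rcases this with rfl | rfl
      · rw [pow_succ, hk2] at hl2
        rcases hκ with rfl | rfl <;> norm_num at hl2
      · rw [pow_succ, hl2] at hk2
        rcases hκ with rfl | rfl <;> norm_num at hk2
    rw [Function.onFun, Set.disjoint_left]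
    intro x hx hx'
    have a := hx.1; have b := hx.2; have c := hx'.1; have d := hx'.2
    rcases key with h1 | h1
    · have : (k : ℝ) + 2 ≤ l := by exact_mod_cast h1
      linarith
    · have : (l : ℝ) + 2 ≤ k := by exact_mod_cast h1
      linarith

lemma abs_parityBinomial_cdf_sub_gaussian_le {h : ℕ} (hh : 0 < h) {κ : ℝ} (hκ : κ = 1 ∨ κ = -1)
    (v : NNReal) (hv : (v : ℝ) = (2 * h + 1) / 4) (y : ℝ) :
    |∑ k ∈ Finset.range (2 * h + 1) with ((k : ℕ) : ℝ) - h ≤ y, parityBinomial (2 * h) κ k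
        - (gaussianReal 0 v).real (Set.Iic y)| ≤
      ((1 + 1 / (2 * h + 1)) * Real.exp (1 / (2 * v)) - 1) + (√(2 * Real.pi * v))⁻¹ := by
  have hv0 : v ≠ 0 := by
    rintro rfl
    have : (0 : ℝ) ≤ h := Nat.cast_nonneg h
    simp only [NNReal.coe_zero] at hv
    linarith
  set c : ℝ := (1 + 1 / (2 * h + 1)) * Real.exp (1 / (2 * v)) with hc
  have hc1 : 1 ≤ c := by
    rw [hc]
    have h1 : (1 : ℝ) ≤ 1 + 1 / (2 * h + 1) := le_add_of_nonneg_right (by positivity)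
    have h2 : (1 : ℝ) ≤ Real.exp (1 / (2 * v)) := Real.one_le_exp (by positivity)
    nlinarith
  set G := gaussianReal 0 v with hG
  have hU := sum_parityBinomial_le_gaussian h hκ v hv
    ((Finset.range (2 * h + 1)).filter fun k => ((k : ℕ) : ℝ) - h ≤ y) (Set.Iic (y + 1))
    (fun k hk x hx => by
      have := (Finset.mem_filter.mp hk).2
      have := hx.2
      simp only [Set.mem_Iic]
      linarith)
  have hL := sum_parityBinomial_le_gaussian h hκ v hv
    ((Finset.range (2 * h + 1)).filter fun k => ¬ ((k : ℕ) : ℝ) - h ≤ y) (Set.Ioi (y - 1))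
    (fun k hk x hx => by
      have := (Finset.mem_filter.mp hk).2
      have := hx.1
      simp only [Set.mem_Ioi]
      linarith)
  have hsum := Finset.sum_filter_add_sum_filter_not (Finset.range (2 * h + 1))
    (fun k => ((k : ℕ) : ℝ) - h ≤ y) (parityBinomial (2 * h) κ)
  rw [sum_parityBinomial (by omega)] at hsum
  rw [← hc, ← hG] at hU hL
  have i1 : G.real (Set.Iic (y + 1)) ≤ G.real (Set.Iic y) + (√(2 * Real.pi * v))⁻¹ := by
    rw [← Set.Iic_union_Ioc_eq_Iic (show y ≤ y + 1 by linarith)]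
    refine (measureReal_union_le _ _).trans (add_le_add_right ?_ _)
    simpa using gaussianReal_real_Ioc_le v hv0 (show y ≤ y + 1 by linarith)
  have i2 : G.real (Set.Ioi (y - 1)) ≤ 1 - G.real (Set.Iic y) + (√(2 * Real.pi * v))⁻¹ := by
    rw [← probReal_compl_eq_one_sub measurableSet_Iic, Set.compl_Iic,
      ← Set.Ioc_union_Ioi_eq_Ioi (show y - 1 ≤ y by linarith), add_comm]
    refine (measureReal_union_le _ _).trans (add_le_add_left ?_ _)
    simpa using gaussianReal_real_Ioc_le v hv0 (show y - 1 ≤ y by linarith)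
  have j1 : G.real (Set.Iic (y + 1)) ≤ 1 := measureReal_le_one
  have j2 : G.real (Set.Ioi (y - 1)) ≤ 1 := measureReal_le_one
  rw [abs_le]
  constructor <;> nlinarith

lemma abs_card_sub_parityBinomial_le {n k : ℕ} {s : Fin k → ℕ} (p : ℕ → Prop) [DecidablePred p] :
    |(((validArrays n k s).filter fun e => p (numOn e)).card : ℝ) / (validArrays n k s).card
        - ∑ i ∈ Finset.range (n + 1) with p i, parityBinomial n (∏ r, (-1 : ℝ) ^ s r) i| ≤
      ∑ S : Fin n → Bool, |stateDiff s S| := by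
  have h1 : (((validArrays n k s).filter fun e => p (numOn e)).card : ℝ) =
      ∑ S : Fin n → Bool with p (trueCount S),
        (((validArrays n k s).filter (fun e => bulbOn e = S)).card : ℝ) := by
    rw [← Nat.cast_sum]
    congr 1
    rw [Finset.card_eq_sum_card_fiberwise (f := fun e => bulbOn e)
      (t := Finset.univ.filter fun S : Fin n → Bool => p (trueCount S))]
    · refine Finset.sum_congr rfl fun S hS => ?_
      have hS' := (Finset.mem_filter.mp hS).2
      congr 1
      ext e
      simp only [Finset.mem_filter]
      constructor
      · exact fun h => ⟨h.1.1, h.2⟩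
      · rintro ⟨h, rfl⟩
        exact ⟨⟨h, hS'⟩, rfl⟩
    · intro e he
      have := (Finset.mem_filter.mp he).2
      exact Finset.mem_coe.mpr (Finset.mem_filter.mpr ⟨Finset.mem_univ _, this⟩)
  rw [h1, Finset.sum_div, ← sum_parityUniform_eq, ← Finset.sum_sub_distrib]
  exact (Finset.abs_sum_le_sum_abs _ _).trans
    (Finset.sum_le_univ_sum_of_nonneg fun _ => abs_nonneg _)

lemma two_pow_div_centralBinom_sq_le (h : ℕ) :
    ((2 : ℝ) ^ (2 * h) / (2 * h).choose h) ^ 2 ≤ 1.6 * (2 * h + 1) := by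
  have h1 := two_pow_sq_le_centralBinom_sq h
  have h0 : (0 : ℝ) < h.centralBinom := by exact_mod_cast h.centralBinom_pos
  rw [← Nat.centralBinom_eq_two_mul_choose, div_pow, div_le_iff₀ (by positivity), ← pow_mul,
    show 2 * h * 2 = 4 * h by ring]
  have hpi := Real.pi_lt_d2
  have : (h.centralBinom : ℝ) ^ 2 * (2 * h + 1) * (Real.pi / 2) ≤
      (h.centralBinom : ℝ) ^ 2 * (2 * h + 1) * 1.6 := by
    gcongr
    linarith
  linarith

lemma centralBinom_le_two_mul_choose {h s : ℕ} (hh : 6 ≤ h)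
    (hs : s = h - 1 ∨ s = h + 1 ∨ s = h + 2) :
    (2 * h).choose h ≤ 2 * (2 * h).choose s := by
  have e1 : (2 * h).choose (h + 1) * (h + 1) = (2 * h).choose h * h := by
    have := Nat.choose_succ_right_eq (2 * h) h
    rwa [show 2 * h - h = h by omega] at this
  have e2 : (2 * h).choose (h + 2) * (h + 2) = (2 * h).choose (h + 1) * (h - 1) := by
    have := Nat.choose_succ_right_eq (2 * h) (h + 1)
    rwa [show 2 * h - (h + 1) = h - 1 by omega] at this
  have e3 : (2 * h).choose (h - 1) = (2 * h).choose (h + 1) := by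
    rw [← Nat.choose_symm (by omega), show 2 * h - (h - 1) = h + 1 by omega]
  have a1 : (2 * h).choose h ≤ 2 * (2 * h).choose (h + 1) := by
    refine Nat.le_of_mul_le_mul_right (c := h + 1) ?_ (by omega)
    rw [mul_assoc, e1]
    calc (2 * h).choose h * (h + 1) ≤ (2 * h).choose h * (2 * h) :=
          Nat.mul_le_mul_left _ (by omega)
      _ = 2 * ((2 * h).choose h * h) := by ring
  rcases hs with rfl | rfl | rfl
  · rwa [e3]
  · exact a1
  · obtain ⟨m, rfl⟩ : ∃ m, h = m + 6 := ⟨h - 6, by omega⟩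
    rw [show m + 6 - 1 = m + 5 by omega] at e2
    clear a1 e3
    generalize (2 * (m + 6)).choose (m + 6) = a at *
    generalize (2 * (m + 6)).choose (m + 6 + 1) = b at *
    generalize (2 * (m + 6)).choose (m + 6 + 2) = c at *
    have : c * ((m + 8) * (m + 7)) = a * ((m + 5) * (m + 6)) := by
      calc c * ((m + 8) * (m + 7)) = c * (m + 6 + 2) * (m + 7) := by ring
        _ = b * (m + 6 + 1) * (m + 5) := by rw [e2]; ring
        _ = _ := by rw [e1]; ring
    have h2 : (m + 8) * (m + 7) ≤ 2 * ((m + 5) * (m + 6)) := by nlinarith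
    have h3 : a * ((m + 8) * (m + 7)) ≤ 2 * c * ((m + 8) * (m + 7)) := by
      calc a * ((m + 8) * (m + 7)) ≤ a * (2 * ((m + 5) * (m + 6))) := Nat.mul_le_mul_left _ h2
        _ = 2 * c * ((m + 8) * (m + 7)) := by rw [mul_assoc 2 c, this]; ring
    exact Nat.le_of_mul_le_mul_right h3 (by positivity)

lemma prod_stageChar_std_le {h : ℕ} (hh : 6 ≤ h) (T : Fin (2 * h) → Bool)
    (h0 : T ≠ fun _ => false) (h1 : T ≠ fun _ => true) :
    ∏ r ∈ Finset.univ.erase (⟨h - 1, by omega⟩ : Fin (2 * h)),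
        stageChar (2 * h) (stdPattern (2 * h) r) T ^ 2 ≤
      (2 ^ (2 * h) / (2 * h).choose h * 2 / (2 * h : ℕ)) ^ 3 := by
  let R : Finset (Fin (2 * h)) := {⟨h - 2, by omega⟩, ⟨h, by omega⟩, ⟨h + 1, by omega⟩}
  have hR : R ⊆ Finset.univ.erase (⟨h - 1, by omega⟩ : Fin (2 * h)) := by
    intro r hr
    simp only [R, Finset.mem_insert, Finset.mem_singleton] at hr
    simp only [Finset.mem_erase, Finset.mem_univ, and_true, ne_eq, Fin.ext_iff]
    rcases hr with rfl | rfl | rfl <;> simp <;> omega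
  rw [← Finset.prod_sdiff hR]
  have hcard : R.card = 3 := by
    refine Finset.card_eq_three.mpr ⟨_, _, _, ?_, ?_, ?_, rfl⟩ <;>
      simp only [ne_eq, Fin.ext_iff] <;> omega
  have hb : ∏ r ∈ R, stageChar (2 * h) (stdPattern (2 * h) r) T ^ 2 ≤
      (2 ^ (2 * h) / (2 * h).choose h * 2 / (2 * h : ℕ)) ^ 3 := by
    rw [← hcard]
    rw [← Finset.prod_const]
    refine Finset.prod_le_prod (fun _ _ => sq_nonneg _) fun r hr => ?_
    have hs : stdPattern (2 * h) r = h - 1 ∨ stdPattern (2 * h) r = h + 1 ∨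
        stdPattern (2 * h) r = h + 2 := by
      simp only [R, Finset.mem_insert, Finset.mem_singleton] at hr
      rcases hr with rfl | rfl | rfl <;> grind [stdPattern]
    have hsn : stdPattern (2 * h) r ≤ 2 * h := by omega
    refine (stageChar_sq_le hsn h0 h1).trans ?_
    gcongr ?_ / _
    have hc : ((2 * h).choose h : ℝ) ≤ 2 * (2 * h).choose (stdPattern (2 * h) r) := by
      exact_mod_cast centralBinom_le_two_mul_choose hh hs
    have hc0 : (0 : ℝ) < (2 * h).choose h := by exact_mod_cast Nat.choose_pos (by omega)
    rw [div_mul_eq_mul_div, div_le_div_iff₀ (by linarith) hc0]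
    have : (0 : ℝ) < 2 ^ (2 * h) := by positivity
    nlinarith
  refine (mul_le_of_le_one_left (Finset.prod_nonneg fun _ _ => sq_nonneg _) ?_).trans hb
  exact Finset.prod_le_one (fun _ _ => sq_nonneg _) fun _ _ => stageChar_sq_le_one _ _ _

lemma sum_abs_stateDiff_std_le {h : ℕ} (hh : 72 < h) :
    ∑ S : Fin (2 * h) → Bool, |stateDiff (stdPattern (2 * h)) S| ≤ 5 / √(2 * h : ℕ) := by
  have hstd : ∀ r, stdPattern (2 * h) r ≤ 2 * h := fun r => r.isLt
  have hsq := sq_sum_abs_stateDiff_le (by omega) hstd (by positivity)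
    (⟨h - 1, by omega⟩ : Fin (2 * h)) (prod_stageChar_std_le (by omega))
  have hE := two_pow_div_centralBinom_sq_le h
  have hr : stdPattern (2 * h) ⟨h - 1, by omega⟩ = h := by
    simp only [stdPattern]
    omega
  rw [hr] at hsq
  set E : ℝ := 2 ^ (2 * h) / (2 * h).choose h
  have hE0 : 0 ≤ E := by positivity
  have hn : (146 : ℝ) ≤ (2 * h : ℕ) := by exact_mod_cast (by omega : 146 ≤ 2 * h)
  have hn' : (2 * (h : ℝ) + 1) = (2 * h : ℕ) + 1 := by push_cast; ring
  rw [hn'] at hE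
  generalize ((2 * h : ℕ) : ℝ) = n at *
  refine le_of_sq_le_sq (hsq.trans ?_) (by positivity)
  have h4 : E * (E * 2 / n) ^ 3 = 8 * (E ^ 2) ^ 2 / n ^ 3 := by ring
  clear_value E
  rw [h4, div_pow, Real.sq_sqrt (by linarith), div_le_div_iff₀ (by positivity) (by positivity)]
  have h5 : (E ^ 2) ^ 2 ≤ (1.6 * (n + 1)) ^ 2 := pow_le_pow_left₀ (sq_nonneg _) hE 2
  have h6 : 8 * (1.6 * (n + 1)) ^ 2 ≤ 25 * n ^ 2 := by nlinarith
  nlinarith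

lemma lam_two {n s : ℕ} (hn : 2 ≤ n) :
    lam n 2 s = (((n : ℝ) - 2 * s) ^ 2 - n) / (n * (n - 1)) := by
  have h1 : (n : ℝ) ≠ 0 := by positivity
  have h2 : (n : ℝ) - 1 ≠ 0 := by
    have : (2 : ℝ) ≤ n := by exact_mod_cast hn
    linarith
  rw [lam]
  simp only [Finset.sum_range_succ, Finset.sum_range_zero, Nat.cast_descFactorial_two,
    Nat.descFactorial_zero, Nat.descFactorial_one, Nat.choose_zero_right, Nat.choose_one_right,
    Nat.choose_self]
  push_cast
  field_simp
  ring

lemma abs_lamPat_two_std_le {h : ℕ} (hh : 3 ≤ h) :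
    |lamPat (2 * h) 2 (stdPattern (2 * h))| ≤
      1 / (((2 * h : ℕ) : ℝ) * ((2 * h : ℕ) - 1)) := by
  have hn : (6 : ℝ) ≤ (2 * h : ℕ) := by exact_mod_cast (by omega : 6 ≤ 2 * h)
  have hle : ∀ r, |lam (2 * h) 2 (stdPattern (2 * h) r)| ≤ 1 := by
    intro r
    have hs : ((stdPattern (2 * h) r : ℕ) : ℝ) ≤ (2 * h : ℕ) := by exact_mod_cast r.isLt
    have hs0 : (0 : ℝ) ≤ stdPattern (2 * h) r := Nat.cast_nonneg _
    rw [lam_two (by omega)]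
    generalize ((2 * h : ℕ) : ℝ) = n at *
    rw [abs_le, div_le_iff₀ (by nlinarith), le_div_iff₀ (by nlinarith)]
    constructor <;> nlinarith [sq_nonneg (n - 2 * (stdPattern (2 * h) r : ℝ))]
  let a : Fin (2 * h) := ⟨h - 1, by omega⟩
  let b : Fin (2 * h) := ⟨h, by omega⟩
  have hab : b ∈ Finset.univ.erase a := by
    simp only [a, b, Finset.mem_erase, Finset.mem_univ, and_true, ne_eq, Fin.ext_iff]
    omega
  have ha : |lam (2 * h) 2 (stdPattern (2 * h) a)| = 1 / ((2 * h : ℕ) - 1) := by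
    have : (stdPattern (2 * h) a : ℝ) = (2 * h : ℕ) / 2 := by
      have : stdPattern (2 * h) a = h := by simp only [a, stdPattern]; omega
      rw [this]; push_cast; ring
    rw [lam_two (by omega), this]
    generalize ((2 * h : ℕ) : ℝ) = n at *
    have h1 : n - 1 ≠ 0 := by linarith
    have h2 : ((n - 2 * (n / 2)) ^ 2 - n) / (n * (n - 1)) = -(1 / (n - 1)) := by
      field_simp
      ring
    rw [h2, abs_neg, abs_of_nonneg (div_nonneg zero_le_one (by linarith))]
  have hb : |lam (2 * h) 2 (stdPattern (2 * h) b)| ≤ 1 / (2 * h : ℕ) := by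
    have : (stdPattern (2 * h) b : ℝ) = (2 * h : ℕ) / 2 + 1 := by
      simp only [b, stdPattern]; push_cast; ring
    rw [lam_two (by omega), this]
    generalize ((2 * h : ℕ) : ℝ) = n at *
    have h1 : n - 1 ≠ 0 := by linarith
    have h2 : ((n - 2 * (n / 2 + 1)) ^ 2 - n) / (n * (n - 1)) = -((n - 4) / (n * (n - 1))) := by
      ring
    rw [h2, abs_neg, abs_of_nonneg (div_nonneg (by linarith) (by nlinarith)),
      div_le_div_iff₀ (by nlinarith) (by linarith)]
    nlinarith
  rw [lamPat, Finset.abs_prod, ← Finset.mul_prod_erase _ _ (Finset.mem_univ a),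
    ← Finset.mul_prod_erase _ _ hab, ha]
  have hrest : ∏ r ∈ (Finset.univ.erase a).erase b, |lam (2 * h) 2 (stdPattern (2 * h) r)| ≤ 1 :=
    Finset.prod_le_one (fun _ _ => abs_nonneg _) fun r _ => hle r
  have hmul := mul_le_mul hb hrest (Finset.prod_nonneg fun _ _ => abs_nonneg _) (by positivity)
  rw [mul_one] at hmul
  refine (mul_le_mul_of_nonneg_left hmul (div_nonneg zero_le_one (by linarith))).trans (le_of_eq ?_)
  rw [div_mul_div_comm, one_mul, mul_comm]

lemma std_variance_bounds {h : ℕ} (hh : 3 ≤ h) {σ : ℝ}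
    (hσ : σ ^ 2 = (((2 * h : ℕ) : ℝ) / 4) * (1 - lamPat (2 * h) 2 (stdPattern (2 * h)))
        + (((2 * h : ℕ) : ℝ) ^ 2 / 4) * lamPat (2 * h) 2 (stdPattern (2 * h))) :
    (((2 * h : ℕ) : ℝ) - 1) / 4 ≤ σ ^ 2 ∧ σ ^ 2 ≤ (((2 * h : ℕ) : ℝ) + 1) / 4 := by
  have hn : (6 : ℝ) ≤ (2 * h : ℕ) := by exact_mod_cast (by omega : 6 ≤ 2 * h)
  have hL := abs_lamPat_two_std_le hh
  generalize ((2 * h : ℕ) : ℝ) = n at *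
  generalize lamPat (2 * h) 2 (stdPattern (2 * h)) = L at *
  have hpos : 0 < n * (n - 1) := by nlinarith
  rw [le_div_iff₀ hpos, ← abs_of_pos hpos, ← abs_mul, abs_le] at hL
  rw [hσ]
  constructor <;> nlinarith

lemma toReal_measure_numOn {n : ℕ} {Ω : Type} [MeasurableSpace Ω] (P : Measure Ω)
    (A : Ω → (Fin n → Fin n → Bool)) (hA : Measurable A)
    (hdist : ∀ e, P {ω | A ω = e} =
      if e ∈ validArrays n n (stdPattern n)
      then ((validArrays n n (stdPattern n)).card : ENNReal)⁻¹ else 0)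
    (p : ℕ → Prop) [DecidablePred p] :
    (P {ω | p (numOn (A ω))}).toReal =
      (((validArrays n n (stdPattern n)).filter fun e => p (numOn e)).card : ℝ) /
        (validArrays n n (stdPattern n)).card := by
  have hset : {ω | p (numOn (A ω))} =
      ⋃ e ∈ (Finset.univ.filter fun e : Fin n → Fin n → Bool => p (numOn e)), {ω | A ω = e} := by
    ext ω
    simp
  rw [hset, measure_biUnion_finset]
  · simp_rw [hdist]
    rw [← Finset.sum_filter, Finset.sum_const, nsmul_eq_mul, Finset.filter_filter]
    rw [ENNReal.toReal_mul, ENNReal.toReal_inv, ENNReal.toReal_natCast, ENNReal.toReal_natCast,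
      div_eq_mul_inv]
    congr 3
    ext e
    simp [and_comm]
  · intro e _ e' _ hne
    rw [Function.onFun, Set.disjoint_left]
    exact fun ω h1 h2 => hne (h1.symm.trans h2)
  · exact fun e _ => hA (measurableSet_singleton e)

lemma sqrt_ge_twelve {n : ℝ} (hn : 146 ≤ n) : 12 ≤ √n :=
  Real.le_sqrt_of_sq_le (by linarith)

lemma twelve_div_sqrt_le {n σ : ℝ} (hn : 6 ≤ n) (hσ : 0 < σ) (hσu : σ ^ 2 ≤ (n + 1) / 4) :
    12 / √n ≤ n / (2 * σ ^ 2) * (1 / (2 * √n) + 1 / (2 * n) + (1 / 3) * Real.exp (-n / 2)) +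
      1.64 * n / σ ^ 3 + 2 / σ := by
  have hs0 : 0 < √n := Real.sqrt_pos.mpr (by linarith)
  have hs2 : √n ^ 2 = n := Real.sq_sqrt (by linarith)
  have h0 : 0 ≤ n / (2 * σ ^ 2) *
      (1 / (2 * √n) + 1 / (2 * n) + (1 / 3) * Real.exp (-n / 2)) := by positivity
  have h1 : 5.6 / σ ≤ 1.64 * n / σ ^ 3 := by
    rw [div_le_div_iff₀ hσ (by positivity)]
    have h : 5.6 * σ ^ 2 ≤ 1.64 * n := by linarith
    have := mul_le_mul_of_nonneg_right h hσ.le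
    linarith [show 5.6 * σ ^ 3 = 5.6 * σ ^ 2 * σ by ring]
  have h2 : σ ≤ 0.55 * √n := by
    refine le_of_sq_le_sq ?_ (by positivity)
    rw [mul_pow, hs2]
    linarith
  have h3 : 12 / √n ≤ 7.6 / σ := by
    rw [div_le_div_iff₀ hs0 hσ]
    linarith
  have h4 : 7.6 / σ = 5.6 / σ + 2 / σ := by ring
  linarith

lemma parityBinomial_cdf_error_le {n : ℝ} (hn : 146 ≤ n) :
    (1 + 1 / (n + 1)) * Real.exp (1 / (2 * ((n + 1) / 4))) - 1 +
      (√(2 * Real.pi * ((n + 1) / 4)))⁻¹ ≤ 2 / √n := by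
  have hs0 : 0 < √n := Real.sqrt_pos.mpr (by linarith)
  have hs2 : √n ^ 2 = n := Real.sq_sqrt (by linarith)
  have a1 : (√(2 * Real.pi * ((n + 1) / 4)))⁻¹ ≤ 1 / √n := by
    rw [one_div]
    refine inv_anti₀ hs0 (Real.sqrt_le_sqrt ?_)
    nlinarith [Real.pi_gt_three]
  have a2 : Real.exp (1 / (2 * ((n + 1) / 4))) ≤ 1 + 4 / n := by
    have hx : 1 / (2 * ((n + 1) / 4)) ≤ 2 / n := by
      rw [div_le_div_iff₀ (by linarith) (by linarith)]
      linarith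
    have hx1 : 2 / n ≤ 1 := by
      rw [div_le_one (by linarith)]
      linarith
    have hx0 : 0 ≤ 2 / n := by positivity
    have hb := Real.abs_exp_sub_one_le (x := 2 / n) (by rwa [abs_of_nonneg hx0])
    rw [abs_of_nonneg hx0] at hb
    have := le_of_abs_le hb
    have := Real.exp_le_exp.mpr hx
    have : 2 * (2 / n) = 4 / n := by ring
    linarith
  have a3 : 1 + 1 / (n + 1) ≤ 1 + 1 / n := by gcongr; linarith
  have a4 : (1 + 1 / (n + 1)) * Real.exp (1 / (2 * ((n + 1) / 4))) ≤
      (1 + 1 / n) * (1 + 4 / n) := mul_le_mul a3 a2 (Real.exp_pos _).le (by positivity)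
  have a5 : (1 + 1 / n) * (1 + 4 / n) - 1 ≤ 1 / √n := by
    have ht := sqrt_ge_twelve hn
    rw [le_div_iff₀ hs0]
    have h1 : ((1 + 1 / n) * (1 + 4 / n) - 1) ≤ 6 / n := by
      have : (1 + 1 / n) * (1 + 4 / n) - 1 = (5 + 4 / n) / n := by field_simp; ring
      rw [this]
      gcongr
      have : 4 / n ≤ 1 := by
        rw [div_le_one (by linarith)]
        linarith
      linarith
    refine (mul_le_mul_of_nonneg_right h1 hs0.le).trans ?_
    rw [div_mul_eq_mul_div, div_le_one (by linarith)]
    nlinarith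
  have : 2 / √n = 1 / √n + 1 / √n := by ring
  linarith

lemma sqrt_variance_ratio_sub_one_le {n w : ℝ} (hn : 146 ≤ n) (hw : (n - 1) / 4 ≤ w) :
    √((n + 1) / 4 / w) - 1 ≤ 1 / √n := by
  have ht := sqrt_ge_twelve hn
  have hs2 : √n ^ 2 = n := Real.sq_sqrt (by linarith)
  have hw0 : 0 < w := by linarith
  have a1 : (n + 1) / 4 / w ≤ (1 + 1 / √n) ^ 2 := by
    have b1 : (n + 1) / 4 / w ≤ 1 + 2 / (n - 1) := by
      have : 1 + 2 / (n - 1) = (n + 1) / (n - 1) := by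
        rw [one_add_div (by linarith)]
        ring
      rw [this, div_div, div_le_div_iff₀ (by positivity) (by linarith)]
      nlinarith
    have b2 : 2 / (n - 1) ≤ 2 / √n := by
      gcongr
      nlinarith
    have b3 : (1 + 1 / √n) ^ 2 = 1 + 2 / √n + (1 / √n) ^ 2 := by ring
    linarith [sq_nonneg (1 / √n)]
  have := Real.sqrt_le_sqrt a1
  rw [Real.sqrt_sq (by positivity)] at this
  linarith

/-- Berry–Esseen bound for the lightbulb process, even case. -/
theorem lightbulb_berry_esseen_even {n : ℕ} (hn6 : 6 ≤ n) (hne : Even n)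
    {Ω : Type} [MeasurableSpace Ω] (P : Measure Ω) [IsProbabilityMeasure P]
    (A : Ω → (Fin n → Fin n → Bool)) (hA : Measurable A)
    (hdist : ∀ e, P {ω | A ω = e} =
      if e ∈ validArrays n n (stdPattern n)
      then ((validArrays n n (stdPattern n)).card : ENNReal)⁻¹ else 0)
    (σ : ℝ) (hσ0 : 0 ≤ σ)
    (hσ2 : σ ^ 2 = ((n : ℝ) / 4) * (1 - lamPat n 2 (stdPattern n))
        + ((n : ℝ) ^ 2 / 4) * lamPat n 2 (stdPattern n)) :
    ∀ z : ℝ,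
      |(P {ω | ((numOn (A ω) : ℝ) - n / 2) / σ ≤ z}).toReal
          - ((gaussianReal 0 1) (Set.Iic z)).toReal|
        ≤ (n : ℝ) / (2 * σ ^ 2) *
              (1 / (2 * Real.sqrt n) + 1 / (2 * (n : ℝ)) + (1 / 3) * Real.exp (-(n : ℝ) / 2))
          + 1.64 * (n : ℝ) / σ ^ 3 + 2 / σ := by
  intro z
  obtain ⟨h, hh⟩ := hne
  obtain rfl : n = 2 * h := by omega
  obtain ⟨hσl, hσu⟩ := std_variance_bounds (by omega) hσ2
  have hn : (6 : ℝ) ≤ (2 * h : ℕ) := by exact_mod_cast hn6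
  have hσ : 0 < σ := by nlinarith
  have hs0 : 0 < √((2 * h : ℕ) : ℝ) := Real.sqrt_pos.mpr (by linarith)
  refine le_trans ?_ (twelve_div_sqrt_le hn hσ hσu)
  rcases Nat.lt_or_ge 72 h with hbig | hsmall
  · have hn' : (146 : ℝ) ≤ (2 * h : ℕ) := by exact_mod_cast (by omega : 146 ≤ 2 * h)
    set κ : ℝ := ∏ r, (-1 : ℝ) ^ stdPattern (2 * h) r with hκdef
    have hκ : κ = 1 ∨ κ = -1 := by
      apply eq_or_eq_neg_of_abs_eq
      simp [hκdef, Finset.abs_prod]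
    let v : NNReal := ⟨(2 * h + 1) / 4, by positivity⟩
    have hv : (v : ℝ) = (2 * h + 1) / 4 := rfl
    have hvn : (v : ℝ) = ((2 * h : ℕ) + 1) / 4 := by rw [hv]; push_cast; ring
    let u : NNReal := ⟨σ ^ 2, by positivity⟩
    have hu : (u : ℝ) = σ ^ 2 := rfl
    have hu0 : u ≠ 0 := by
      intro hc
      have : (u : ℝ) = 0 := by rw [hc]; rfl
      rw [hu] at this
      nlinarith
    have huv : u ≤ v := by
      rw [← NNReal.coe_le_coe, hu, hvn]
      exact hσu
    have hset : {ω | ((numOn (A ω) : ℝ) - (2 * h : ℕ) / 2) / σ ≤ z} =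
        {ω | ((numOn (A ω) : ℕ) : ℝ) - h ≤ σ * z} := by
      ext ω
      simp only [Set.mem_ofPred_eq]
      rw [div_le_iff₀ hσ, mul_comm z]
      push_cast
      rw [mul_div_cancel_left₀ _ two_ne_zero]
    rw [hset, toReal_measure_numOn P A hA hdist (fun k => (k : ℝ) - h ≤ σ * z),
      ← gaussianReal_Iic_mul hσ u hu z, ← Measure.real]
    have d1 := (abs_card_sub_parityBinomial_le (s := stdPattern (2 * h))
      (fun k => (k : ℝ) - h ≤ σ * z)).trans (sum_abs_stateDiff_std_le hbig)
    rw [← hκdef] at d1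
    have d2 := abs_parityBinomial_cdf_sub_gaussian_le (by omega : 0 < h) hκ v hv (σ * z)
    have d3 := abs_real_sub_le_of_le_mul
      (fun s _ => gaussianReal_real_le_of_var_le hu0 huv s) (measurableSet_Iic (a := σ * z))
    have e2 : (1 + 1 / (2 * (h : ℝ) + 1)) * Real.exp (1 / (2 * v)) - 1 +
        (√(2 * Real.pi * v))⁻¹ ≤ 2 / √((2 * h : ℕ) : ℝ) := by
      rw [show 2 * (h : ℝ) + 1 = (2 * h : ℕ) + 1 by push_cast; ring, hvn]
      exact parityBinomial_cdf_error_le hn'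
    have e3 : √((v : ℝ) / u) - 1 ≤ 1 / √((2 * h : ℕ) : ℝ) := by
      rw [hvn, hu]
      exact sqrt_variance_ratio_sub_one_le hn' hσl
    have e4 : 12 / √((2 * h : ℕ) : ℝ) = 5 / √((2 * h : ℕ) : ℝ) + 2 / √((2 * h : ℕ) : ℝ) +
        1 / √((2 * h : ℕ) : ℝ) + 4 / √((2 * h : ℕ) : ℝ) := by ring
    have e5 : 0 ≤ 4 / √((2 * h : ℕ) : ℝ) := by positivity
    rw [abs_le] at d1 d2 d3 ⊢
    constructor <;> linarith [d1.1, d1.2, d2.1, d2.2, d3.1, d3.2]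
  · have hs : √((2 * h : ℕ) : ℝ) ≤ 12 := by
      refine Real.sqrt_le_iff.mpr ⟨by norm_num, ?_⟩
      exact_mod_cast (by omega : 2 * h ≤ 12 ^ 2)
    have h1 : (1 : ℝ) ≤ 12 / √((2 * h : ℕ) : ℝ) := by rwa [one_le_div hs0]
    refine le_trans ?_ h1
    rw [← measureReal_def, ← measureReal_def]
    exact abs_sub_le_of_nonneg_of_le measureReal_nonneg measureReal_le_one measureReal_nonneg
      measureReal_le_one
end

section
/- Let n be even and let X be the number of bulbs on at the terminal time n of the standard lightbulb process on n bulbs. Then there exist, on a common probability space, random variables X' and X^s such that X' has the same distribution as X, X^s has the X'-size bias distribution, and X^s − X' ∈ {0, 2} almost surely; in particular X' ≤ X^s ≤ X' + 2 almost surely. -/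
open MeasureTheory ProbabilityTheory Finset

/-- `Ys` has the `Y`-size bias distribution:
`E[Y g(Y)] = (E Y) · E[g(Ys)]` for every bounded measurable `g`. -/
def HasSizeBias {Ω : Type*} [MeasurableSpace Ω] (P : Measure Ω) (Y Ys : Ω → ℝ) : Prop :=
  ∀ g : ℝ → ℝ, Measurable g → (∃ C, ∀ x, |g x| ≤ C) →
    ∫ ω, Y ω * g (Y ω) ∂P = (∫ ω, Y ω ∂P) * ∫ ω, g (Ys ω) ∂P

/-- Exchange the switch variables of bulbs `i` and `j` in stage `m`. -/
def swapStage {n k : ℕ} (e : Fin k → Fin n → Bool) (m : Fin k) (i j : Fin n) :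
    Fin k → Fin n → Bool :=
  Function.update e m (fun x => e m (Equiv.swap i j x))

/-- Valid arrays together with an ordered pair of bulbs whose switch variables differ in
stage `m`. -/
def switchTriples (n k : ℕ) (s : Fin k → ℕ) (m : Fin k) :
    Finset ((Fin k → Fin n → Bool) × Fin n × Fin n) :=
  Finset.univ.filter (fun t => t.1 ∈ validArrays n k s ∧ t.1 m t.2.1 ≠ t.1 m t.2.2)

lemma swapStage_swapStage {n k : ℕ} (e : Fin k → Fin n → Bool) (m : Fin k) (i j : Fin n) :
    swapStage (swapStage e m i j) m i j = e := by
  simp [swapStage]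

lemma swapStage_mem_validArrays {n k : ℕ} {s : Fin k → ℕ} {e : Fin k → Fin n → Bool}
    (he : e ∈ validArrays n k s) (m : Fin k) (i j : Fin n) :
    swapStage e m i j ∈ validArrays n k s := by
  simp only [validArrays, Finset.mem_filter, Finset.mem_univ, true_and] at he ⊢
  intro r
  rw [← he r]
  by_cases hr : r = m
  · subst hr
    exact Finset.card_equiv (Equiv.swap i j) (by simp [swapStage])
  · simp [swapStage, hr]

lemma bulbOn_congr {n k : ℕ} {e e' : Fin k → Fin n → Bool} {x : Fin n}
    (h : ∀ r, e' r x = e r x) : bulbOn e' x = bulbOn e x := by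
  simp [bulbOn, h]

lemma bulbOn_eq_not {n k : ℕ} {e e' : Fin k → Fin n → Bool} {x : Fin n} (m : Fin k)
    (hm : e' m x = !e m x) (h : ∀ r, r ≠ m → e' r x = e r x) :
    bulbOn e' x = !bulbOn e x := by
  have hrest : ∑ r ∈ Finset.univ.erase m, (if e' r x = true then 1 else 0)
      = ∑ r ∈ Finset.univ.erase m, (if e r x = true then 1 else 0) :=
    Finset.sum_congr rfl fun r hr => by rw [h r (Finset.ne_of_mem_erase hr)]
  unfold bulbOn
  rw [Finset.card_filter, Finset.card_filter, ← Finset.add_sum_erase _ _ (Finset.mem_univ m),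
    ← Finset.add_sum_erase _ _ (Finset.mem_univ m), hrest, hm, ← decide_not, decide_eq_decide]
  cases e m x <;> simp <;> omega

lemma bulbOn_swapStage_left {n k : ℕ} {e : Fin k → Fin n → Bool} {m : Fin k} {i j : Fin n}
    (h : e m i ≠ e m j) : bulbOn (swapStage e m i j) i = !bulbOn e i := by
  refine bulbOn_eq_not m ?_ fun r hr => by simp [swapStage, hr]
  simp only [swapStage, Function.update_self, Equiv.swap_apply_left]
  exact Bool.eq_not.mpr h.symm

lemma bulbOn_swapStage_right {n k : ℕ} {e : Fin k → Fin n → Bool} {m : Fin k} {i j : Fin n}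
    (h : e m i ≠ e m j) : bulbOn (swapStage e m i j) j = !bulbOn e j := by
  refine bulbOn_eq_not m ?_ fun r hr => by simp [swapStage, hr]
  simp only [swapStage, Function.update_self, Equiv.swap_apply_right]
  exact Bool.eq_not.mpr h

lemma bulbOn_swapStage_of_ne {n k : ℕ} (e : Fin k → Fin n → Bool) (m : Fin k) {i j x : Fin n}
    (hi : x ≠ i) (hj : x ≠ j) : bulbOn (swapStage e m i j) x = bulbOn e x := by
  refine bulbOn_congr fun r => ?_
  by_cases hr : r = m
  · subst hr
    simp [swapStage, Equiv.swap_apply_of_ne_of_ne hi hj]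
  · simp [swapStage, hr]

lemma numOn_swapStage {n k : ℕ} {e : Fin k → Fin n → Bool} {m : Fin k} {i j : Fin n}
    (h : e m i ≠ e m j) (hi : bulbOn e i = false) :
    numOn (swapStage e m i j) = numOn e ∨ numOn (swapStage e m i j) = numOn e + 2 := by
  have hji : j ∈ Finset.univ.erase i :=
    Finset.mem_erase.mpr ⟨fun hij => h (by rw [hij]), Finset.mem_univ j⟩
  have hrest : ∑ x ∈ (Finset.univ.erase i).erase j,
        (if bulbOn (swapStage e m i j) x = true then 1 else 0)
      = ∑ x ∈ (Finset.univ.erase i).erase j, (if bulbOn e x = true then 1 else 0) :=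
    Finset.sum_congr rfl fun x hx => by
      simp only [Finset.mem_erase] at hx
      rw [bulbOn_swapStage_of_ne e m hx.2.1 hx.1]
  unfold numOn
  rw [Finset.card_filter, Finset.card_filter, ← Finset.add_sum_erase _ _ (Finset.mem_univ i),
    ← Finset.add_sum_erase _ _ hji, hrest, ← Finset.add_sum_erase _ _ (Finset.mem_univ i),
    ← Finset.add_sum_erase _ _ hji, bulbOn_swapStage_left h, bulbOn_swapStage_right h, hi]
  cases bulbOn e j <;> simp; omega

lemma card_filter_ne_of_balanced {h : ℕ} {n : ℕ} (hn : n = 2 * h) {f : Fin n → Bool}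
    (hf : (Finset.univ.filter (fun j => f j = true)).card = h) (i : Fin n) :
    (Finset.univ.filter (fun j => f i ≠ f j)).card = h := by
  have hsplit := Finset.card_filter_add_card_filter_not (s := (Finset.univ : Finset (Fin n)))
    (fun j => f j = true)
  rw [Finset.card_univ, Fintype.card_fin, hf] at hsplit
  cases hfi : f i
  · rw [← hf]
    congr 1
    ext j
    cases f j <;> simp
  · simp only [Bool.not_eq_true] at hsplit
    have hcongr : Finset.univ.filter (fun j => true ≠ f j)
        = Finset.univ.filter (fun j => f j = false) := by
      ext j; cases f j <;> simp
    rw [hcongr]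
    omega

lemma sum_switchTriples {n k h : ℕ} {s : Fin k → ℕ} {m : Fin k} (hn : n = 2 * h) (hm : s m = h)
    {M : Type*} [AddCommMonoid M] (F : (Fin k → Fin n → Bool) → Fin n → M) :
    ∑ t ∈ switchTriples n k s m, F t.1 t.2.1
      = h • ∑ e ∈ validArrays n k s, ∑ i, F e i := by
  have hprod : ∑ t ∈ switchTriples n k s m, F t.1 t.2.1
      = ∑ e ∈ validArrays n k s, ∑ i, ∑ j ∈ Finset.univ.filter (fun j => e m i ≠ e m j), F e i := by
    simp only [switchTriples, Finset.sum_filter, Fintype.sum_prod_type, ite_and]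
    rw [← Finset.sum_filter_add_sum_filter_not Finset.univ (· ∈ validArrays n k s)]
    rw [Finset.filter_mem_eq_inter, Finset.univ_inter]
    rw [Finset.sum_eq_zero (s := Finset.univ.filter (· ∉ validArrays n k s)), add_zero]
    · exact Finset.sum_congr rfl fun e he => by simp [he]
    · intro e he
      simp [(Finset.mem_filter.mp he).2]
  rw [hprod, Finset.smul_sum]
  refine Finset.sum_congr rfl fun e he => ?_
  rw [Finset.smul_sum]
  refine Finset.sum_congr rfl fun i _ => ?_
  rw [Finset.sum_const, card_filter_ne_of_balanced hn
    (((Finset.mem_filter.mp he).2 m).trans hm)]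

/-- The terminal count after forcing bulb `i` to be on by a switch exchange with bulb `j`. -/
def forcedCount {n k : ℕ} (m : Fin k) (t : (Fin k → Fin n → Bool) × Fin n × Fin n) : ℕ :=
  if bulbOn t.1 t.2.1 = true then numOn t.1 else numOn (swapStage t.1 m t.2.1 t.2.2)

lemma swapStage_mem_switchTriples {n k : ℕ} {s : Fin k → ℕ} {m : Fin k}
    {t : (Fin k → Fin n → Bool) × Fin n × Fin n} (ht : t ∈ switchTriples n k s m) :
    (swapStage t.1 m t.2.1 t.2.2, t.2) ∈ switchTriples n k s m := by
  simp only [switchTriples, Finset.mem_filter, Finset.mem_univ, true_and] at ht ⊢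
  refine ⟨swapStage_mem_validArrays ht.1 _ _ _, ?_⟩
  simpa [swapStage] using ht.2.symm

lemma sum_forcedCount {n k : ℕ} (s : Fin k → ℕ) (m : Fin k) (g : ℕ → ℝ) :
    ∑ t ∈ switchTriples n k s m, g (forcedCount m t)
      = 2 * ∑ t ∈ switchTriples n k s m, if bulbOn t.1 t.2.1 = true then g (numOn t.1) else 0 := by
  have hswap : ∑ t ∈ switchTriples n k s m,
        (if bulbOn t.1 t.2.1 = true then 0 else g (numOn (swapStage t.1 m t.2.1 t.2.2)))
      = ∑ t ∈ switchTriples n k s m, if bulbOn t.1 t.2.1 = true then g (numOn t.1) else 0 := by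
    refine Finset.sum_nbij' (fun t => (swapStage t.1 m t.2.1 t.2.2, t.2))
      (fun t => (swapStage t.1 m t.2.1 t.2.2, t.2))
      (fun t ht => swapStage_mem_switchTriples ht) (fun t ht => swapStage_mem_switchTriples ht)
      (fun t _ => by simp [swapStage_swapStage]) (fun t _ => by simp [swapStage_swapStage])
      fun t ht => ?_
    have hne := (Finset.mem_filter.mp ht).2.2
    simp only [bulbOn_swapStage_left hne]
    cases bulbOn t.1 t.2.1 <;> simp
  rw [two_mul]
  nth_rewrite 1 [← hswap]
  rw [← Finset.sum_add_distrib]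
  refine Finset.sum_congr rfl fun t _ => ?_
  unfold forcedCount
  split_ifs <;> simp

lemma sum_numOn_mul {n k h : ℕ} {s : Fin k → ℕ} {m : Fin k} (hn : n = 2 * h) (hm : s m = h)
    (g : ℕ → ℝ) :
    ∑ t ∈ switchTriples n k s m, (numOn t.1 : ℝ) * g (numOn t.1)
      = h * ∑ t ∈ switchTriples n k s m, g (forcedCount m t) := by
  rw [sum_forcedCount, sum_switchTriples hn hm (fun e _ => (numOn e : ℝ) * g (numOn e)),
    sum_switchTriples hn hm (fun e i => if bulbOn e i = true then g (numOn e) else 0)]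
  have hcount (e : Fin k → Fin n → Bool) :
      ∑ i, (if bulbOn e i = true then g (numOn e) else 0) = (numOn e : ℝ) * g (numOn e) := by
    rw [← Finset.sum_filter, Finset.sum_const, nsmul_eq_mul, numOn]
  simp only [hcount, Finset.sum_const, Finset.card_univ, Fintype.card_fin, nsmul_eq_mul,
    ← Finset.mul_sum]
  subst hn
  push_cast
  ring

lemma card_filter_switchTriples {n k h : ℕ} {s : Fin k → ℕ} {m : Fin k} (hn : n = 2 * h)
    (hm : s m = h) (p : (Fin k → Fin n → Bool) → Prop) [DecidablePred p] :
    ((switchTriples n k s m).filter (fun t => p t.1)).card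
      = h * n * ((validArrays n k s).filter p).card := by
  rw [Finset.card_filter, sum_switchTriples hn hm (fun e _ => if p e then 1 else 0)]
  simp only [Finset.sum_const, Finset.card_univ, Fintype.card_fin, smul_eq_mul,
    ← Finset.mul_sum, Finset.card_filter, mul_assoc]

lemma validArrays_stdPattern_nonempty (n : ℕ) : (validArrays n n (stdPattern n)).Nonempty := by
  refine ⟨fun r j => decide (j ≤ r), ?_⟩
  refine Finset.mem_filter.mpr ⟨Finset.mem_univ _, fun r => ?_⟩
  rw [stdPattern, ← Fin.card_Iic r]
  congr 1
  ext j
  simp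

/-- The uniform probability measure on the elements of a nonempty finite set. -/
lemma exists_uniform_measure {α : Type} {S : Finset α} (hS : S.Nonempty) :
    ∃ (_ : MeasurableSpace S) (P : Measure S), IsProbabilityMeasure P ∧
      (∀ f : S → ℕ, Measurable f) ∧
      (∀ (p : α → Prop) [DecidablePred p],
        P {ω | p ω} = ((S.filter p).card : ENNReal) / (S.card : ENNReal)) ∧
      ∀ f : α → ℝ, ∫ ω, f ω ∂P = (S.card : ℝ)⁻¹ * ∑ t ∈ S, f t := by
  let _ : MeasurableSpace S := ⊤
  have hS0 : (S.card : ENNReal) ≠ 0 := by simpa using hS.ne_empty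
  have hset (p : α → Prop) [DecidablePred p] :
      ((S.card : ENNReal)⁻¹ • (Measure.count : Measure S)) {ω | p ω}
        = ((S.filter p).card : ENNReal) / (S.card : ENNReal) := by
    have hcoe : {ω : S | p ω} = ((Finset.univ.filter (fun ω : S => p ω) : Finset S) : Set S) := by
      ext; simp
    rw [Measure.smul_apply, hcoe, Measure.count_apply_finset, smul_eq_mul, mul_comm,
      ← div_eq_mul_inv, Finset.card_filter, Finset.card_filter,
      Finset.sum_coe_sort S (fun a => if p a then 1 else 0)]
  refine ⟨inferInstance, (S.card : ENNReal)⁻¹ • Measure.count, ⟨?_⟩, fun f => measurable_from_top,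
    fun p _ => hset p, fun f => ?_⟩
  · have htop := hset (fun _ => True)
    simp only [Set.ofPred_true, Finset.filter_true] at htop
    rw [htop, ENNReal.div_self hS0 (ENNReal.natCast_ne_top _)]
  · rw [integral_smul_measure, integral_count, Finset.sum_coe_sort S f]
    simp

/-- Bounded monotone size bias coupling for the lightbulb process, even case: there is a
coupling of a copy `X'` of the terminal count `X` with a variable `Xs` having the `X'`-size
bias distribution such that `Xs - X' ∈ {0, 2}` almost surely. -/
theorem lightbulb_size_bias_coupling_even {n : ℕ} (hne : Even n) :
    ∃ (Ω : Type) (_ : MeasurableSpace Ω) (P : Measure Ω) (_ : IsProbabilityMeasure P)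
      (X' Xs : Ω → ℕ),
      Measurable X' ∧ Measurable Xs ∧
      (∀ v : ℕ, P {ω | X' ω = v}
        = (((validArrays n n (stdPattern n)).filter (fun e => numOn e = v)).card : ENNReal)
            / ((validArrays n n (stdPattern n)).card : ENNReal)) ∧
      HasSizeBias P (fun ω => (X' ω : ℝ)) (fun ω => (Xs ω : ℝ)) ∧
      (∀ᵐ ω ∂P, Xs ω = X' ω ∨ Xs ω = X' ω + 2) ∧
      (∀ᵐ ω ∂P, X' ω ≤ Xs ω ∧ Xs ω ≤ X' ω + 2) := by
  obtain ⟨h, hh⟩ := hne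
  have hn : n = 2 * h := by omega
  rcases Nat.eq_zero_or_pos h with h0 | hpos
  · obtain rfl : n = 0 := by omega
    have hnum (e : Fin 0 → Fin 0 → Bool) : numOn e = 0 := by simp [numOn]
    have hcard : (validArrays 0 0 (stdPattern 0)).card ≠ 0 :=
      (validArrays_stdPattern_nonempty 0).card_ne_zero
    refine ⟨Unit, inferInstance, Measure.dirac (), inferInstance, fun _ => 0, fun _ => 0,
      measurable_const, measurable_const, fun v => ?_, fun g _ _ => by simp, by simp, by simp⟩
    simp only [hnum]
    by_cases hv : 0 = v
    · simp [hv, ENNReal.div_self (Nat.cast_ne_zero.mpr hcard) (ENNReal.natCast_ne_top _)]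
    · simp [hv]
  · set m : Fin n := ⟨h - 1, by omega⟩ with hm_def
    have hm : stdPattern n m = h := by simp only [stdPattern, hm_def]; omega
    set T := switchTriples n n (stdPattern n) m with hT
    have hcard : T.card = h * n * (validArrays n n (stdPattern n)).card := by
      simpa using card_filter_switchTriples hn hm (fun _ => True)
    have hcard0 : T.card ≠ 0 := by
      rw [hcard]
      exact mul_ne_zero (mul_ne_zero (by omega) (by omega))
        (validArrays_stdPattern_nonempty n).card_ne_zero
    obtain ⟨_, P, hP, hmeas, hset, hint⟩ :=
      exists_uniform_measure (Finset.card_pos.mp (Nat.pos_of_ne_zero hcard0))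
    have hcoupling (t : T) :
        forcedCount m t.1 = numOn t.1.1 ∨ forcedCount m t.1 = numOn t.1.1 + 2 := by
      unfold forcedCount
      split_ifs with hon
      · exact Or.inl rfl
      · exact numOn_swapStage (Finset.mem_filter.mp t.2).2.2 (by simpa using hon)
    refine ⟨T, _, P, hP, fun t => numOn t.1.1, fun t => forcedCount m t.1, hmeas _, hmeas _,
      fun v => ?_, fun g _ _ => ?_, ae_of_all _ hcoupling, ae_of_all _ fun t => ?_⟩
    · rw [hset (fun t => numOn t.1 = v), card_filter_switchTriples hn hm (fun e => numOn e = v),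
        hcard, Nat.cast_mul (h * n), Nat.cast_mul (h * n), ENNReal.mul_div_mul_left]
      · exact Nat.cast_ne_zero.mpr (mul_ne_zero (by omega) (by omega))
      · exact ENNReal.natCast_ne_top _
    · have hmean := sum_numOn_mul hn hm (fun _ => 1)
      have hbias := sum_numOn_mul hn hm (fun x => g x)
      simp only [mul_one, Finset.sum_const, nsmul_eq_mul, ← hT] at hmean hbias
      rw [hint (fun t => (numOn t.1 : ℝ) * g (numOn t.1)), hint (fun t => (numOn t.1 : ℝ)),
        hint (fun t => g (forcedCount m t)), hbias, hmean]
      have : (T.card : ℝ) ≠ 0 := Nat.cast_ne_zero.mpr hcard0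
      field_simp
    · rcases hcoupling t with ht | ht <;> simp [ht]
end

section
/- Let n ≥ 6 be even, let 𝐗 = (X_{rj}) be the switch variables of the standard lightbulb process on n bulbs with terminal bulb states X_j, and define U_n = (4/n²)·Σ_{i ≠ j} 1{X_i = 0, X_j = 0, X_{n/2,i} = 0, X_{n/2,j} = 1}. Then E U_n = (1/4)(1 − λ_{n,2,𝐧_{n/2}}) and Var(U_n) = 1/(4n) + 1/(4n²) + (1/16)(λ_{n,4,𝐧_{n/2}} − λ_{n,2,𝐧_{n/2}}²) − (1/(2n²))·λ_{n,2,𝐧_{n/2}} + ((1−n)/(4n²))·λ_{n,4,𝐧_{n/2}}. Consequently, sqrt(Var(U_n)) ≤ 1/(2√n) + 1/(2n) + (1/3)e^{−n/2}. -/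
open MeasureTheory ProbabilityTheory Finset

/-- `λ_{n,b,𝐧_l}`, where `𝐧_l` is the pattern `(1,…,n)` with the entry `l` deleted. -/
noncomputable def lamDel (n b l : ℕ) : ℝ := ∏ r ∈ (Finset.Icc 1 n).erase l, lam n b r

/-- The sign `-1` of a toggle, `1` otherwise. -/
def toggleSign (b : Bool) : ℝ := if b then -1 else 1

/-- The single-stage configurations with exactly `s` toggles. -/
def stageConfigs (n s : ℕ) : Finset (Fin n → Bool) :=
  Finset.univ.filter (fun v => (Finset.univ.filter (fun j => v j = true)).card = s)

lemma card_stageConfigs_superset {n s : ℕ} (T : Finset (Fin n)) (hT : T.card ≤ s) :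
    ((stageConfigs n s).filter (fun v => ∀ j ∈ T, v j = true)).card
      = (n - T.card).choose (s - T.card) := by
  classical
  have hc : (n - T.card) = Tᶜ.card := by rw [Finset.card_compl, Fintype.card_fin]
  rw [hc, ← Finset.card_powersetCard]
  refine Finset.card_bij' (fun v _ => (Finset.univ.filter (fun j => v j = true)) \ T)
    (fun S _ => fun j => decide (j ∈ S ∪ T)) ?_ ?_ ?_ ?_
  · intro v hv
    simp only [stageConfigs, Finset.mem_filter, Finset.mem_univ, true_and] at hv
    rw [Finset.mem_powersetCard]
    refine ⟨fun j hj => by simp at hj ⊢; exact hj.2, ?_⟩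
    rw [Finset.card_sdiff_of_subset (fun j hj => by simpa using hv.2 j hj), hv.1]
  · intro S hS
    rw [Finset.mem_powersetCard] at hS
    simp only [stageConfigs, Finset.mem_filter, Finset.mem_univ, true_and, decide_eq_true_eq]
    refine ⟨?_, fun j hj => Finset.mem_union_right _ hj⟩
    have : Finset.univ.filter (fun j => j ∈ S ∪ T) = S ∪ T := by ext; simp
    rw [this, Finset.card_union_of_disjoint, hS.2]
    · omega
    · exact Finset.disjoint_left.2 fun j hj => by simpa using hS.1 hj
  · intro v hv
    simp only [stageConfigs, Finset.mem_filter, Finset.mem_univ, true_and] at hv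
    funext j
    by_cases hj : j ∈ T
    · simp [hj, hv.2 j hj]
    · simp [hj]
  · intro S hS
    rw [Finset.mem_powersetCard] at hS
    ext j
    have := @hS.1 j
    simp at this ⊢
    tauto

lemma card_stageConfigs {n s : ℕ} : (stageConfigs n s).card = n.choose s := by
  simpa using card_stageConfigs_superset (s := s) (∅ : Finset (Fin n)) (by simp)

lemma card_stageConfigs_superset_real {n s : ℕ} (T : Finset (Fin n)) :
    (((stageConfigs n s).filter (fun v => ∀ j ∈ T, v j = true)).card : ℝ)
      = n.choose s * (s.descFactorial T.card / n.descFactorial T.card) := by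
  have hTn : T.card ≤ n := by simpa using T.card_le_univ
  have h0 : (n.descFactorial T.card : ℝ) ≠ 0 := by
    exact_mod_cast (Nat.descFactorial_pos.2 hTn).ne'
  by_cases hT : T.card ≤ s
  · rw [card_stageConfigs_superset T hT, mul_div_assoc', eq_div_iff h0]
    have h := Nat.choose_mul (n := n) hT
    rw [Nat.descFactorial_eq_factorial_mul_choose, Nat.descFactorial_eq_factorial_mul_choose]
    have h' : (n.choose s : ℝ) * s.choose T.card
        = n.choose T.card * (n - T.card).choose (s - T.card) := by exact_mod_cast h
    push_cast
    linear_combination (-(T.card.factorial : ℝ)) * h'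
  · have : (stageConfigs n s).filter (fun v => ∀ j ∈ T, v j = true) = ∅ := by
      refine Finset.filter_eq_empty_iff.2 fun v hv hvT => hT ?_
      simp only [stageConfigs, Finset.mem_filter, Finset.mem_univ, true_and] at hv
      rw [← hv]
      exact Finset.card_le_card fun j hj => by simpa using hvT j hj
    rw [this, Nat.descFactorial_of_lt (not_le.1 hT)]
    simp

lemma prod_toggleSign_eq_sum {n : ℕ} (B : Finset (Fin n)) (v : Fin n → Bool) :
    ∏ j ∈ B, toggleSign (v j)
      = ∑ T ∈ B.powerset, if ∀ j ∈ T, v j = true then (-2 : ℝ) ^ T.card else 0 := by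
  have h : ∀ j ∈ B, toggleSign (v j) = 1 + (if v j = true then (-2 : ℝ) else 0) := by
    intro j _
    unfold toggleSign
    split_ifs <;> norm_num
  rw [Finset.prod_congr rfl h, Finset.prod_one_add]
  refine Finset.sum_congr rfl fun T _ => ?_
  rw [Finset.prod_ite_zero]
  simp

lemma sum_stageConfigs_prod_toggleSign {n s : ℕ} (B : Finset (Fin n)) :
    ∑ v ∈ stageConfigs n s, ∏ j ∈ B, toggleSign (v j) = n.choose s * lam n B.card s := by
  simp_rw [prod_toggleSign_eq_sum]
  rw [Finset.sum_comm]
  have h : ∀ T ∈ B.powerset,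
      (∑ v ∈ stageConfigs n s, if ∀ j ∈ T, v j = true then (-2 : ℝ) ^ T.card else 0)
        = (fun t => (-2 : ℝ) ^ t *
            (n.choose s * (s.descFactorial t / n.descFactorial t))) T.card := by
    intro T _
    rw [← Finset.sum_filter, Finset.sum_const, nsmul_eq_mul, card_stageConfigs_superset_real]
    ring
  rw [Finset.sum_congr rfl h, Finset.sum_powerset_apply_card (fun t => (-2 : ℝ) ^ t *
    (n.choose s * (s.descFactorial t / n.descFactorial t))), lam, Finset.mul_sum]
  refine Finset.sum_congr rfl fun t _ => ?_
  rw [nsmul_eq_mul]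
  ring

lemma abs_toggleSign (b : Bool) : |toggleSign b| = 1 := by
  cases b <;> simp [toggleSign]

lemma abs_lam_le_one {n b s : ℕ} (hb : b ≤ n) (hs : s ≤ n) : |lam n b s| ≤ 1 := by
  obtain ⟨B, -, hB⟩ := Finset.exists_subset_card_eq
    (show b ≤ (Finset.univ : Finset (Fin n)).card by simpa using hb)
  have h := sum_stageConfigs_prod_toggleSign (s := s) B
  rw [hB] at h
  have hpos : (0 : ℝ) < n.choose s := by exact_mod_cast Nat.choose_pos hs
  have h1 : |(n.choose s : ℝ) * lam n b s| ≤ n.choose s := by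
    rw [← h]
    refine (Finset.abs_sum_le_sum_abs _ _).trans ?_
    simp [Finset.abs_prod, abs_toggleSign, card_stageConfigs]
  rw [abs_mul, abs_of_pos hpos] at h1
  exact le_of_mul_le_mul_left (by simpa using h1) hpos

/-- The parity sign of bulb `j` accumulated over all stages except `l`. -/
def paritySignDel {n k : ℕ} (l : Fin k) (e : Fin k → Fin n → Bool) (j : Fin n) : ℝ :=
  ∏ r ∈ Finset.univ.erase l, toggleSign (e r j)

lemma paritySignDel_sq {n k : ℕ} (l : Fin k) (e : Fin k → Fin n → Bool) (j : Fin n) :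
    paritySignDel l e j ^ 2 = 1 := by
  rw [paritySignDel, ← Finset.prod_pow]
  exact Finset.prod_eq_one fun r _ => by rw [← sq_abs, abs_toggleSign, one_pow]

lemma toggleSign_mul_paritySignDel {n k : ℕ} (l : Fin k) (e : Fin k → Fin n → Bool) (j : Fin n) :
    toggleSign (e l j) * paritySignDel l e j = if bulbOn e j = false then 1 else -1 := by
  rw [paritySignDel, Finset.mul_prod_erase _ (fun r => toggleSign (e r j)) (Finset.mem_univ l)]
  have h : ∏ r, toggleSign (e r j)
      = (-1 : ℝ) ^ (Finset.univ.filter (fun r => e r j = true)).card := by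
    simp [toggleSign, Finset.prod_ite]
  rw [h, bulbOn]
  rcases Nat.mod_two_eq_zero_or_one (Finset.univ.filter (fun r => e r j = true)).card with h0 | h0
  · rw [(Nat.even_iff.2 h0).neg_one_pow]
    simp [h0]
  · rw [(Nat.odd_iff.2 h0).neg_one_pow]
    simp [h0]

/-- Valid arrays whose stage `l` equals `h`. -/
def stageFiber (n k : ℕ) (s : Fin k → ℕ) (l : Fin k) (h : Fin n → Bool) :
    Finset (Fin k → Fin n → Bool) :=
  (validArrays n k s).filter (fun e => e l = h)

lemma sum_stageFiber_prod {n k : ℕ} {s : Fin k → ℕ} {l : Fin k} {h : Fin n → Bool}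
    (hh : h ∈ stageConfigs n (s l)) (B : Finset (Fin n)) :
    ∑ e ∈ stageFiber n k s l h, ∏ j ∈ B, paritySignDel l e j
      = (∏ r ∈ Finset.univ.erase l, (n.choose (s r) : ℝ))
        * ∏ r ∈ Finset.univ.erase l, lam n B.card (s r) := by
  have hf : stageFiber n k s l h
      = Fintype.piFinset (fun r => if r = l then {h} else stageConfigs n (s r)) := by
    ext e
    simp only [stageFiber, validArrays, Finset.mem_filter, Finset.mem_univ, true_and,
      Fintype.mem_piFinset]
    constructor
    · rintro ⟨h1, h2⟩ r
      split_ifs with hr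
      · rw [hr, h2]
        exact Finset.mem_singleton_self h
      · simpa [stageConfigs] using h1 r
    · intro H
      have hl : e l = h := by simpa using H l
      refine ⟨fun r => ?_, hl⟩
      by_cases hr : r = l
      · rw [hr, hl]
        simpa [stageConfigs] using hh
      · simpa [stageConfigs, hr] using H r
  have hp : ∀ e : Fin k → Fin n → Bool, ∏ j ∈ B, paritySignDel l e j
      = ∏ r, if r = l then 1 else ∏ j ∈ B, toggleSign (e r j) := by
    intro e
    simp only [paritySignDel]
    rw [Finset.prod_comm, ← Finset.mul_prod_erase Finset.univ _ (Finset.mem_univ l), if_pos rfl,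
      one_mul]
    exact Finset.prod_congr rfl fun r hr => (if_neg (Finset.ne_of_mem_erase hr)).symm
  simp_rw [hp]
  rw [hf, ← Finset.prod_univ_sum (fun r => if r = l then {h} else stageConfigs n (s r))
    (fun r v => if r = l then (1 : ℝ) else ∏ j ∈ B, toggleSign (v j)),
    ← Finset.mul_prod_erase Finset.univ _ (Finset.mem_univ l), ← Finset.prod_mul_distrib]
  simp only [if_true, Finset.sum_singleton, one_mul]
  refine Finset.prod_congr rfl fun r hr => ?_
  simp only [if_neg (Finset.ne_of_mem_erase hr)]
  exact sum_stageConfigs_prod_toggleSign B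

/-- The elementary symmetric sum of degree `k` of the values of `x` on `G`. -/
def elemSym {ι : Type*} (x : ι → ℝ) (G : Finset ι) (k : ℕ) : ℝ :=
  ∑ B ∈ G.powersetCard k, ∏ j ∈ B, x j

lemma elemSym_zero {ι : Type*} (x : ι → ℝ) (G : Finset ι) : elemSym x G 0 = 1 := by
  simp [elemSym]

lemma elemSym_one {ι : Type*} (x : ι → ℝ) (G : Finset ι) : elemSym x G 1 = ∑ j ∈ G, x j := by
  simp [elemSym, Finset.powersetCard_one]

lemma sq_sum_eq_card_add_elemSym {ι : Type*} [DecidableEq ι] {x : ι → ℝ}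
    (hx : ∀ i, x i ^ 2 = 1) (G : Finset ι) :
    (∑ j ∈ G, x j) ^ 2 = G.card + 2 * elemSym x G 2 := by
  induction G using Finset.induction_on with
  | empty => simp [elemSym, Finset.powersetCard_eq_empty.2 (show (∅ : Finset ι).card < 2 by simp)]
  | insert a G ha ih =>
    have h : elemSym x (insert a G) 2 = elemSym x G 2 + x a * ∑ j ∈ G, x j := by
      rw [← elemSym_one]
      simp only [elemSym]
      rw [Finset.powersetCard_succ_insert ha, Finset.sum_union, Finset.sum_image, Finset.mul_sum]
      · congr 1
        refine Finset.sum_congr rfl fun B hB => ?_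
        rw [Finset.prod_insert]
        exact fun h => ha ((Finset.mem_powersetCard.1 hB).1 h)
      · intro B hB C hC hBC
        have hB' : a ∉ B := fun h => ha ((Finset.mem_powersetCard.1 hB).1 h)
        have hC' : a ∉ C := fun h => ha ((Finset.mem_powersetCard.1 hC).1 h)
        rw [← Finset.erase_insert hB', hBC, Finset.erase_insert hC']
      · refine Finset.disjoint_left.2 fun B hB hB2 => ?_
        obtain ⟨C, -, rfl⟩ := Finset.mem_image.1 hB2
        exact ha ((Finset.mem_powersetCard.1 hB).1 (Finset.mem_insert_self a C))
    rw [Finset.sum_insert ha, h, Finset.card_insert_of_notMem ha]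
    push_cast
    linear_combination ih + hx a

/-- Joint moments of elementary symmetric sums of signs whose mixed moments depend only on the
number of factors. -/
lemma sum_elemSym_mul_elemSym {α ι : Type*} [DecidableEq ι] {S : Finset α} {x : α → ι → ℝ}
    {K : ℝ} {L : ℕ → ℝ} (hS : ∀ B : Finset ι, ∑ e ∈ S, ∏ j ∈ B, x e j = K * L B.card)
    {G H : Finset ι} (hGH : Disjoint G H) (k l : ℕ) :
    ∑ e ∈ S, elemSym (x e) G k * elemSym (x e) H l
      = K * (G.card.choose k * H.card.choose l * L (k + l)) := by
  have h : ∀ B ∈ G.powersetCard k, ∀ C ∈ H.powersetCard l,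
      ∑ e ∈ S, (∏ j ∈ B, x e j) * ∏ j ∈ C, x e j = K * L (k + l) := by
    intro B hB C hC
    rw [Finset.mem_powersetCard] at hB hC
    have hd : Disjoint B C := Finset.disjoint_of_subset_left hB.1
      (Finset.disjoint_of_subset_right hC.1 hGH)
    simp_rw [← Finset.prod_union hd]
    rw [hS, Finset.card_union_of_disjoint hd, hB.2, hC.2]
  simp only [elemSym, Finset.sum_mul_sum]
  rw [Finset.sum_comm, Finset.sum_congr rfl fun B hB => by
    rw [Finset.sum_comm, Finset.sum_congr rfl (h B hB)]]
  simp only [Finset.sum_const, Finset.card_powersetCard, nsmul_eq_mul]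
  ring

section Moments

variable {α ι : Type*} [DecidableEq ι] {S : Finset α} {x : α → ι → ℝ} {K : ℝ} {L : ℕ → ℝ}
  {G H : Finset ι} {m : ℕ}

lemma sum_add_mul_sub (hS : ∀ B : Finset ι, ∑ e ∈ S, ∏ j ∈ B, x e j = K * L B.card)
    (h0 : L 0 = 1) (hGH : Disjoint G H) (hG : G.card = m) (hH : H.card = m) :
    ∑ e ∈ S, (m + ∑ j ∈ G, x e j) * (m - ∑ j ∈ H, x e j) = K * (m ^ 2 * (1 - L 2)) := by
  have key := sum_elemSym_mul_elemSym hS hGH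
  have e : ∀ e ∈ S, (m + ∑ j ∈ G, x e j) * (m - ∑ j ∈ H, x e j)
      = (m : ℝ) ^ 2 * (elemSym (x e) G 0 * elemSym (x e) H 0)
        - m * (elemSym (x e) G 0 * elemSym (x e) H 1)
        + m * (elemSym (x e) G 1 * elemSym (x e) H 0)
        - elemSym (x e) G 1 * elemSym (x e) H 1 := by
    intro e _
    rw [elemSym_zero, elemSym_zero, elemSym_one, elemSym_one]
    ring
  rw [Finset.sum_congr rfl e]
  simp only [Finset.sum_add_distrib, Finset.sum_sub_distrib, ← Finset.mul_sum, key, hG, hH,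
    Nat.choose_zero_right, Nat.choose_one_right, h0, add_zero, zero_add, one_add_one_eq_two,
    Nat.cast_one]
  ring

lemma sum_sq_add_mul_sub (hx : ∀ e i, x e i ^ 2 = 1)
    (hS : ∀ B : Finset ι, ∑ e ∈ S, ∏ j ∈ B, x e j = K * L B.card)
    (h0 : L 0 = 1) (hGH : Disjoint G H) (hG : G.card = m) (hH : H.card = m) :
    ∑ e ∈ S, ((m + ∑ j ∈ G, x e j) * (m - ∑ j ∈ H, x e j)) ^ 2
      = K * (4 * m ^ 3 * (1 - L 2) + m ^ 2 * (m - 1) ^ 2 * (1 - 2 * L 2 + L 4)) := by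
  have key := sum_elemSym_mul_elemSym hS hGH
  have e : ∀ e ∈ S, ((m + ∑ j ∈ G, x e j) * (m - ∑ j ∈ H, x e j)) ^ 2
      = ((m : ℝ) ^ 2 + m) ^ 2 * (elemSym (x e) G 0 * elemSym (x e) H 0)
        - (m ^ 2 + m) * (2 * m) * (elemSym (x e) G 0 * elemSym (x e) H 1)
        + (m ^ 2 + m) * 2 * (elemSym (x e) G 0 * elemSym (x e) H 2)
        + (m ^ 2 + m) * (2 * m) * (elemSym (x e) G 1 * elemSym (x e) H 0)
        - (2 * m) * (2 * m) * (elemSym (x e) G 1 * elemSym (x e) H 1)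
        + (2 * m) * 2 * (elemSym (x e) G 1 * elemSym (x e) H 2)
        + (m ^ 2 + m) * 2 * (elemSym (x e) G 2 * elemSym (x e) H 0)
        - (2 * m) * 2 * (elemSym (x e) G 2 * elemSym (x e) H 1)
        + 2 * 2 * (elemSym (x e) G 2 * elemSym (x e) H 2) := by
    intro e _
    have h1 := sq_sum_eq_card_add_elemSym (hx e) G
    have h2 := sq_sum_eq_card_add_elemSym (hx e) H
    rw [hG] at h1
    rw [hH] at h2
    rw [elemSym_zero, elemSym_zero, elemSym_one, elemSym_one]
    have h3 : (m + ∑ j ∈ G, x e j) ^ 2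
        = m ^ 2 + m + 2 * m * ∑ j ∈ G, x e j + 2 * elemSym (x e) G 2 := by
      linear_combination h1
    have h4 : (m - ∑ j ∈ H, x e j) ^ 2
        = m ^ 2 + m - 2 * m * ∑ j ∈ H, x e j + 2 * elemSym (x e) H 2 := by
      linear_combination h2
    rw [mul_pow, h3, h4]
    ring
  rw [Finset.sum_congr rfl e]
  simp only [Finset.sum_add_distrib, Finset.sum_sub_distrib, ← Finset.mul_sum, key, hG, hH,
    Nat.choose_zero_right, Nat.choose_one_right, h0, add_zero, zero_add, one_add_one_eq_two,
    Nat.cast_one, Nat.cast_choose_two, Nat.reduceAdd]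
  ring

end Moments

lemma prod_erase_lam_stdPattern {n : ℕ} (l : Fin n) (b : ℕ) :
    ∏ r ∈ Finset.univ.erase l, lam n b (stdPattern n r) = lamDel n b ((l : ℕ) + 1) := by
  rw [lamDel]
  refine Finset.prod_bij (fun r _ => (r : ℕ) + 1) ?_ ?_ ?_ ?_
  · intro r hr
    have h1 := r.isLt
    have h2 : (r : ℕ) ≠ l := fun h => Finset.ne_of_mem_erase hr (Fin.ext h)
    rw [Finset.mem_erase, Finset.mem_Icc]
    omega
  · intro r _ r' _ h
    exact Fin.ext (by omega)
  · intro t ht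
    rw [Finset.mem_erase, Finset.mem_Icc] at ht
    refine ⟨⟨t - 1, by omega⟩, ?_, ?_⟩
    · refine Finset.mem_erase.2 ⟨fun h => ?_, Finset.mem_univ _⟩
      have := congrArg Fin.val h
      simp only at this
      omega
    · simp only
      omega
  · intro r _
    rfl

/-- A function whose average over every stage fibre is `c` has average `c` over the valid arrays. -/
lemma sum_validArrays_of_stageFiber {n k : ℕ} {s : Fin k → ℕ} (l : Fin k)
    (f : (Fin k → Fin n → Bool) → ℝ) (c : ℝ)
    (hf : ∀ h ∈ stageConfigs n (s l),
      ∑ e ∈ stageFiber n k s l h, f e = (stageFiber n k s l h).card * c) :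
    ∑ e ∈ validArrays n k s, f e = (validArrays n k s).card * c := by
  have hmaps : ∀ e ∈ validArrays n k s, e l ∈ stageConfigs n (s l) := by
    intro e he
    simp only [validArrays, Finset.mem_filter, Finset.mem_univ, true_and] at he
    simpa [stageConfigs] using he l
  rw [← Finset.sum_fiberwise_of_maps_to hmaps, Finset.card_eq_sum_card_fiberwise hmaps]
  push_cast
  rw [Finset.sum_mul]
  exact Finset.sum_congr rfl hf

lemma card_stageFiber {n k : ℕ} {s : Fin k → ℕ} {l : Fin k} {h : Fin n → Bool}
    (hh : h ∈ stageConfigs n (s l)) :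
    ((stageFiber n k s l h).card : ℝ) = ∏ r ∈ Finset.univ.erase l, (n.choose (s r) : ℝ) := by
  have := sum_stageFiber_prod hh ∅
  simpa [lam] using this

lemma card_validArrays_pos {n k : ℕ} {s : Fin k → ℕ} (hs : ∀ r, s r ≤ n) :
    0 < (validArrays n k s).card := by
  have h : ∀ r, ∃ v, v ∈ stageConfigs n (s r) := fun r => by
    rw [← Finset.Nonempty, ← Finset.card_pos, card_stageConfigs]
    exact Nat.choose_pos (hs r)
  choose v hv using h
  refine Finset.card_pos.2 ⟨v, ?_⟩
  simp only [validArrays, Finset.mem_filter, Finset.mem_univ, true_and]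
  exact fun r => by simpa [stageConfigs] using hv r

lemma sum_offDiag_eq_mul {n k m : ℕ} {l : Fin k} (e : Fin k → Fin n → Bool)
    (hG : (Finset.univ.filter (fun j => e l j = false)).card = m)
    (hH : (Finset.univ.filter (fun j => e l j = true)).card = m) :
    ∑ p ∈ (Finset.univ : Finset (Fin n)).offDiag,
        (if bulbOn e p.1 = false ∧ bulbOn e p.2 = false ∧
            e l p.1 = false ∧ e l p.2 = true then (1 : ℝ) else 0)
      = (1 / 4) * ((m + ∑ j ∈ Finset.univ.filter (fun j => e l j = false), paritySignDel l e j)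
          * (m - ∑ j ∈ Finset.univ.filter (fun j => e l j = true), paritySignDel l e j)) := by
  have hm1 : (m : ℝ) + ∑ j ∈ Finset.univ.filter (fun j => e l j = false), paritySignDel l e j
      = ∑ j ∈ Finset.univ.filter (fun j => e l j = false), (1 + paritySignDel l e j) := by
    rw [Finset.sum_add_distrib, Finset.sum_const, hG, nsmul_one]
  have hm2 : (m : ℝ) - ∑ j ∈ Finset.univ.filter (fun j => e l j = true), paritySignDel l e j
      = ∑ j ∈ Finset.univ.filter (fun j => e l j = true), (1 - paritySignDel l e j) := by
    rw [Finset.sum_sub_distrib, Finset.sum_const, hH, nsmul_one]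
  rw [hm1, hm2, Finset.sum_mul_sum, ← Finset.sum_product', Finset.mul_sum]
  symm
  refine Finset.sum_subset_zero_on_sdiff ?_ ?_ ?_
  · rintro ⟨i, j⟩ hp
    simp only [Finset.mem_product, Finset.mem_filter, Finset.mem_univ, true_and] at hp
    simp only [Finset.mem_offDiag, Finset.mem_univ, true_and]
    rintro rfl
    simp [hp.1] at hp
  · rintro ⟨i, j⟩ hp
    simp only [Finset.mem_sdiff, Finset.mem_product, Finset.mem_filter, Finset.mem_univ,
      true_and] at hp
    exact if_neg fun h => hp.2 h.2.2
  · rintro ⟨i, j⟩ hp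
    simp only [Finset.mem_product, Finset.mem_filter, Finset.mem_univ, true_and] at hp
    have hi := toggleSign_mul_paritySignDel l e i
    have hj := toggleSign_mul_paritySignDel l e j
    rw [hp.1] at hi
    rw [hp.2] at hj
    simp only [toggleSign, if_true, Bool.false_eq_true, if_false] at hi hj
    have hi' : paritySignDel l e i = if bulbOn e i = false then 1 else -1 := by linarith
    have hj' : paritySignDel l e j = -(if bulbOn e j = false then 1 else -1) := by linarith
    simp only [hi', hj', hp.1, hp.2, and_true]
    cases bulbOn e i <;> cases bulbOn e j <;> norm_num

lemma integral_comp_eq_average {n k : ℕ} {s : Fin k → ℕ} {Ω : Type*} [MeasurableSpace Ω]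
    (P : Measure Ω) [IsProbabilityMeasure P] {A : Ω → (Fin k → Fin n → Bool)} (hA : Measurable A)
    (hdist : ∀ e, P {ω | A ω = e} =
      if e ∈ validArrays n k s then ((validArrays n k s).card : ENNReal)⁻¹ else 0)
    (f : (Fin k → Fin n → Bool) → ℝ) :
    ∫ ω, f (A ω) ∂P
      = ((validArrays n k s).card : ℝ)⁻¹ * ∑ e ∈ validArrays n k s, f e := by
  have : IsProbabilityMeasure (P.map A) := Measure.isProbabilityMeasure_map hA.aemeasurable
  rw [← integral_map (f := f) hA.aemeasurable (measurable_of_finite f).aestronglyMeasurable,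
    integral_fintype .of_finite, Finset.mul_sum, ← Finset.sum_subset (Finset.subset_univ _)]
  · refine Finset.sum_congr rfl fun e he => ?_
    rw [map_measureReal_apply hA (MeasurableSet.singleton e), measureReal_def]
    change (P {ω | A ω = e}).toReal • f e = _
    rw [hdist, if_pos he]
    simp
  · intro e _ he
    rw [map_measureReal_apply hA (MeasurableSet.singleton e), measureReal_def]
    change (P {ω | A ω = e}).toReal • f e = _
    rw [hdist, if_neg he]
    simp

lemma abs_lamDel_le_abs_lam {n b l t : ℕ} (hb : b ≤ n) (ht : t ∈ (Finset.Icc 1 n).erase l) :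
    |lamDel n b l| ≤ |lam n b t| := by
  rw [lamDel, ← Finset.mul_prod_erase _ _ ht, abs_mul, Finset.abs_prod]
  refine mul_le_of_le_one_right (abs_nonneg _) (Finset.prod_le_one (fun _ _ => abs_nonneg _) ?_)
  intro r hr
  have := Finset.mem_of_mem_erase (Finset.mem_of_mem_erase hr)
  exact abs_lam_le_one hb (Finset.mem_Icc.1 this).2

lemma lam_four_half_add_one (k : ℕ) :
    lam (2 * k + 6) 4 (k + 4)
      = 3 * (k - 1) / ((k + 3) * (2 * k + 5) * (2 * k + 3)) := by
  have h1 : (k + 3 : ℝ) ≠ 0 := by positivity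
  have h2 : (2 * k + 5 : ℝ) ≠ 0 := by positivity
  have h3 : (2 * k + 3 : ℝ) ≠ 0 := by positivity
  have h4 : (k + 2 : ℝ) ≠ 0 := by positivity
  simp only [lam, Finset.sum_range_succ, Finset.sum_range_zero, Nat.descFactorial_succ,
    Nat.descFactorial_zero, show Nat.choose 4 2 = 6 from rfl, show Nat.choose 4 1 = 4 from rfl,
    show Nat.choose 4 3 = 4 from rfl, show Nat.choose 4 4 = 1 from rfl,
    show Nat.choose 4 0 = 1 from rfl, show 2 * k + 6 - 0 = 2 * (k + 3) by omega,
    show 2 * k + 6 - 1 = 2 * k + 5 by omega, show 2 * k + 6 - 2 = 2 * (k + 2) by omega,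
    show 2 * k + 6 - 3 = 2 * k + 3 by omega, show k + 4 - 0 = k + 4 by omega,
    show k + 4 - 1 = k + 3 by omega, show k + 4 - 2 = k + 2 by omega,
    show k + 4 - 3 = k + 1 by omega]
  push_cast
  field_simp
  ring

lemma abs_lam_four_half_add_one_le (k : ℕ) :
    |lam (2 * k + 6) 4 (k + 4)| ≤ 3 / (2 * k + 6 : ℝ) ^ 2 := by
  have hk : (0 : ℝ) ≤ k := Nat.cast_nonneg k
  have hd : (0 : ℝ) < (k + 3) * (2 * k + 5) * (2 * k + 3) := by positivity
  rw [lam_four_half_add_one, abs_div, abs_of_pos hd, div_le_div_iff₀ hd (by positivity),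
    abs_mul, abs_of_pos (by norm_num : (0 : ℝ) < 3)]
  have : |(k : ℝ) - 1| * (4 * (k + 3)) ≤ (2 * k + 5) * (2 * k + 3) := by
    rcases abs_cases ((k : ℝ) - 1) with ⟨h, _⟩ | ⟨h, _⟩ <;> rw [h] <;> nlinarith
  calc 3 * |(k : ℝ) - 1| * (2 * k + 6) ^ 2
      = 3 * (k + 3) * (|(k : ℝ) - 1| * (4 * (k + 3))) := by ring
    _ ≤ 3 * (k + 3) * ((2 * k + 5) * (2 * k + 3)) := by gcongr
    _ = _ := by ring

lemma abs_lamDel_four_half_le {n : ℕ} (hn6 : 6 ≤ n) (hne : Even n) :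
    |lamDel n 4 (n / 2)| ≤ 3 / (n : ℝ) ^ 2 := by
  obtain ⟨m, hm⟩ := hne
  obtain ⟨k, rfl⟩ : ∃ k, n = 2 * k + 6 := ⟨m - 3, by omega⟩
  have ht : k + 4 ∈ (Finset.Icc 1 (2 * k + 6)).erase ((2 * k + 6) / 2) := by
    rw [Finset.mem_erase, Finset.mem_Icc]
    omega
  refine (abs_lamDel_le_abs_lam (by omega) ht).trans ?_
  simpa using abs_lam_four_half_add_one_le k

lemma abs_lamDel_two_half_le_one {n : ℕ} (hn : 6 ≤ n) : |lamDel n 2 (n / 2)| ≤ 1 := by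
  have ht : 1 ∈ (Finset.Icc 1 n).erase (n / 2) := by
    rw [Finset.mem_erase, Finset.mem_Icc]
    omega
  exact (abs_lamDel_le_abs_lam (by omega) ht).trans (abs_lam_le_one (by omega) (by omega))

lemma sqrt_variance_formula_le {x a b c : ℝ} (hx : 6 ≤ x) (ha : |a| ≤ 1) (hb : |b| ≤ 3 / x ^ 2)
    (hc : 0 ≤ c) :
    Real.sqrt (1 / (4 * x) + 1 / (4 * x ^ 2) + (1 / 16) * (b - a ^ 2)
        - (1 / (2 * x ^ 2)) * a + ((1 - x) / (4 * x ^ 2)) * b)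
      ≤ 1 / (2 * Real.sqrt x) + 1 / (2 * x) + c := by
  have hx0 : 0 < x := by linarith
  obtain ⟨y, hy, rfl⟩ : ∃ y, 0 < y ∧ x = y ^ 2 :=
    ⟨Real.sqrt x, Real.sqrt_pos.2 hx0, (Real.sq_sqrt hx0.le).symm⟩
  have hy2 : 2 ≤ y := by nlinarith
  obtain ⟨u, hu, hu2, rfl⟩ : ∃ u, 0 < u ∧ u ≤ 1 / 2 ∧ y = 1 / u :=
    ⟨1 / y, by positivity, one_div_le_one_div_of_le two_pos hy2, (one_div_one_div y).symm⟩
  rw [Real.sqrt_sq hy.le]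
  have h1 : 1 / (4 * (1 / u) ^ 2) = u ^ 2 / 4 := by field_simp
  have h2 : 1 / (4 * ((1 / u) ^ 2) ^ 2) = u ^ 4 / 4 := by field_simp
  have h3 : 1 / (2 * ((1 / u) ^ 2) ^ 2) = u ^ 4 / 2 := by field_simp
  have h4 : (1 - (1 / u) ^ 2) / (4 * ((1 / u) ^ 2) ^ 2) = (u ^ 4 - u ^ 2) / 4 := by
    field_simp
  have h5 : 3 / ((1 / u) ^ 2) ^ 2 = 3 * u ^ 4 := by field_simp
  have h6 : 1 / (2 * (1 / u)) = u / 2 := by field_simp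
  have h7 : 1 / (2 * (1 / u) ^ 2) = u ^ 2 / 2 := by field_simp
  rw [h5] at hb
  rw [h1, h2, h3, h4, h6, h7]
  refine Real.sqrt_le_iff.2 ⟨by positivity, ?_⟩
  have hu4 : 0 < u ^ 4 := by positivity
  have hB : (1 / 16 - u ^ 2 / 4 + u ^ 4 / 4) * b ≤ 1 / 16 * (3 * u ^ 4) := by
    have hc1 : 0 ≤ 1 / 16 - u ^ 2 / 4 + u ^ 4 / 4 := by nlinarith [sq_nonneg (1 / 4 - u ^ 2 / 2)]
    have hc2 : 1 / 16 - u ^ 2 / 4 + u ^ 4 / 4 ≤ 1 / 16 := by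
      nlinarith [mul_nonneg (sq_nonneg u) (show (0 : ℝ) ≤ 1 - u ^ 2 by nlinarith)]
    calc _ ≤ (1 / 16 - u ^ 2 / 4 + u ^ 4 / 4) * (3 * u ^ 4) := by
          gcongr
          exact (abs_le.1 hb).2
      _ ≤ _ := by gcongr
  have hA : -(u ^ 4 / 2 * a) ≤ u ^ 4 / 2 := by nlinarith [(abs_le.1 ha).1]
  have hR : (u / 2 + u ^ 2 / 2) ^ 2 ≤ (u / 2 + u ^ 2 / 2 + c) ^ 2 :=
    pow_le_pow_left₀ (by positivity) (by linarith) 2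
  have hU : u ^ 4 ≤ u ^ 3 / 2 := by nlinarith [pow_pos hu 3]
  nlinarith [sq_nonneg a, pow_pos hu 3]

/-- Mean and variance of `U_n`, and the variance bound, for the even lightbulb process. -/
theorem lightbulb_Un_mean_variance {n : ℕ} (hn6 : 6 ≤ n) (hne : Even n)
    {Ω : Type} [MeasurableSpace Ω] (P : Measure Ω) [IsProbabilityMeasure P]
    (A : Ω → (Fin n → Fin n → Bool)) (hA : Measurable A)
    (hdist : ∀ e, P {ω | A ω = e} =
      if e ∈ validArrays n n (stdPattern n)
      then ((validArrays n n (stdPattern n)).card : ENNReal)⁻¹ else 0)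
    (half : Fin n) (hhalf : (half : ℕ) + 1 = n / 2)
    (U : Ω → ℝ)
    (hU : ∀ ω, U ω = (4 / (n : ℝ) ^ 2) *
      ∑ p ∈ (Finset.univ : Finset (Fin n)).offDiag,
        (if bulbOn (A ω) p.1 = false ∧ bulbOn (A ω) p.2 = false ∧
            A ω half p.1 = false ∧ A ω half p.2 = true then (1 : ℝ) else 0)) :
    (∫ ω, U ω ∂P = (1 / 4) * (1 - lamDel n 2 (n / 2))) ∧
    (variance U P
      = 1 / (4 * (n : ℝ)) + 1 / (4 * (n : ℝ) ^ 2)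
        + (1 / 16) * (lamDel n 4 (n / 2) - lamDel n 2 (n / 2) ^ 2)
        - (1 / (2 * (n : ℝ) ^ 2)) * lamDel n 2 (n / 2)
        + ((1 - (n : ℝ)) / (4 * (n : ℝ) ^ 2)) * lamDel n 4 (n / 2)) ∧
    Real.sqrt (variance U P)
      ≤ 1 / (2 * Real.sqrt n) + 1 / (2 * (n : ℝ)) + (1 / 3) * Real.exp (-(n : ℝ) / 2) := by
  obtain ⟨m, hm⟩ := hne
  have hnm : n / 2 = m := by omega
  have hm0 : (m : ℝ) ≠ 0 := by
    have : m ≠ 0 := by omega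
    exact_mod_cast this
  have hnR : (n : ℝ) = 2 * m := by
    rw [hm]
    push_cast
    ring
  have hs : stdPattern n half = m := by rw [stdPattern, hhalf, hnm]
  have hlam : ∀ b, ∏ r ∈ Finset.univ.erase half, lam n b (stdPattern n r) = lamDel n b m :=
    fun b => by rw [prod_erase_lam_stdPattern, hhalf, hnm]
  set V := validArrays n n (stdPattern n) with hV
  set f : (Fin n → Fin n → Bool) → ℝ := fun e => (4 / (n : ℝ) ^ 2) *
      ∑ p ∈ (Finset.univ : Finset (Fin n)).offDiag,
        (if bulbOn e p.1 = false ∧ bulbOn e p.2 = false ∧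
            e half p.1 = false ∧ e half p.2 = true then (1 : ℝ) else 0) with hf
  have hUf : U = fun ω => f (A ω) := funext hU
  have hV0 : (V.card : ℝ) ≠ 0 := by
    have : 0 < V.card := card_validArrays_pos fun r => r.isLt
    exact_mod_cast this.ne'
  have hcount : ∀ h ∈ stageConfigs n (stdPattern n half),
      (Finset.univ.filter (fun j => h j = false)).card = m ∧
      (Finset.univ.filter (fun j => h j = true)).card = m := by
    intro h hh
    have h1 : (Finset.univ.filter (fun j => h j = true)).card = m := by
      simpa [stageConfigs, hs] using hh
    have h2 := Finset.card_filter_add_card_filter_not (s := (Finset.univ : Finset (Fin n)))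
      (fun j => h j = true)
    simp only [Bool.not_eq_true, Finset.card_univ, Fintype.card_fin] at h2
    exact ⟨by omega, h1⟩
  have hdisj : ∀ h : Fin n → Bool, Disjoint (Finset.univ.filter (fun j => h j = false))
      (Finset.univ.filter (fun j => h j = true)) := fun h =>
    Finset.disjoint_filter.2 fun j _ h1 h2 => by simp [h1] at h2
  have hfib : ∀ h ∈ stageConfigs n (stdPattern n half),
      ∀ e ∈ stageFiber n n (stdPattern n) half h, f e = (1 / (4 * (m : ℝ) ^ 2)) *
        ((m + ∑ j ∈ Finset.univ.filter (fun j => h j = false), paritySignDel half e j)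
          * (m - ∑ j ∈ Finset.univ.filter (fun j => h j = true), paritySignDel half e j)) := by
    intro h hh e he
    obtain rfl : e half = h := (Finset.mem_filter.1 he).2
    simp only [hf]
    rw [sum_offDiag_eq_mul e (hcount _ hh).1 (hcount _ hh).2, hnR]
    field_simp
    ring
  have hmom : ∀ h ∈ stageConfigs n (stdPattern n half), ∀ B : Finset (Fin n),
      ∑ e ∈ stageFiber n n (stdPattern n) half h, ∏ j ∈ B, paritySignDel half e j
        = (stageFiber n n (stdPattern n) half h).card * lamDel n B.card m := fun h hh B => by
    rw [sum_stageFiber_prod hh, hlam, card_stageFiber hh]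
  have hL0 : lamDel n 0 m = 1 := by simp [lamDel, lam]
  have hmean : ∑ e ∈ V, f e = V.card * ((1 / 4) * (1 - lamDel n 2 m)) := by
    refine sum_validArrays_of_stageFiber half f _ fun h hh => ?_
    rw [Finset.sum_congr rfl (hfib h hh), ← Finset.mul_sum,
      sum_add_mul_sub (L := fun b => lamDel n b m) (hmom h hh) hL0 (hdisj h) (hcount h hh).1
        (hcount h hh).2]
    field_simp
  have hsq : ∑ e ∈ V, f e ^ 2 = V.card * ((1 / (16 * (m : ℝ) ^ 4)) *
      (4 * m ^ 3 * (1 - lamDel n 2 m)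
        + m ^ 2 * (m - 1) ^ 2 * (1 - 2 * lamDel n 2 m + lamDel n 4 m))) := by
    refine sum_validArrays_of_stageFiber half (fun e => f e ^ 2) _ fun h hh => ?_
    rw [Finset.sum_congr rfl fun e he => by rw [hfib h hh e he, mul_pow], ← Finset.mul_sum,
      sum_sq_add_mul_sub (L := fun b => lamDel n b m) (paritySignDel_sq half) (hmom h hh) hL0
        (hdisj h) (hcount h hh).1 (hcount h hh).2]
    field_simp
    ring
  have hE : ∫ ω, U ω ∂P = (1 / 4) * (1 - lamDel n 2 (n / 2)) := by
    rw [hUf, integral_comp_eq_average P hA hdist f, hmean, hnm, inv_mul_cancel_left₀ hV0]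
  have hMem : MemLp U 2 P := by
    have : IsProbabilityMeasure (P.map A) := Measure.isProbabilityMeasure_map hA.aemeasurable
    rw [hUf]
    exact MemLp.comp_of_map (f := A) (g := f) (MemLp.of_discrete) hA.aemeasurable
  have hVar : variance U P
      = 1 / (4 * (n : ℝ)) + 1 / (4 * (n : ℝ) ^ 2)
        + (1 / 16) * (lamDel n 4 (n / 2) - lamDel n 2 (n / 2) ^ 2)
        - (1 / (2 * (n : ℝ) ^ 2)) * lamDel n 2 (n / 2)
        + ((1 - (n : ℝ)) / (4 * (n : ℝ) ^ 2)) * lamDel n 4 (n / 2) := by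
    have hE2 : ∫ ω, (U ^ 2) ω ∂P = (1 / (16 * (m : ℝ) ^ 4)) *
        (4 * m ^ 3 * (1 - lamDel n 2 m)
          + m ^ 2 * (m - 1) ^ 2 * (1 - 2 * lamDel n 2 m + lamDel n 4 m)) := by
      rw [hUf]
      exact (integral_comp_eq_average P hA hdist (fun e => f e ^ 2)).trans
        (by rw [hsq, inv_mul_cancel_left₀ hV0])
    rw [variance_eq_sub hMem, hE2, hE, hnm, hnR]
    field_simp
    ring
  refine ⟨hE, hVar, ?_⟩
  rw [hVar]
  exact sqrt_variance_formula_le (by exact_mod_cast hn6) (abs_lamDel_two_half_le_one hn6)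
    (abs_lamDel_four_half_le hn6 ⟨m, hm⟩) (by positivity)
end
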